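/- Let d ≥ 1, β > 0, and let h ∈ (ℝ^d)^ℕ be a deterministic field satisfying: m_n → m ∈ ℝ^d, s_n → s ∈ (0,∞)^d, Σ_{(i,j)∈ℕ×{1,…,d}} |h_j(i)|/2^{i+j} < ∞, and at least one of the following: (1) m ≠ 0; (2) m = 0 and ‖s‖ ≥ 1; (3) m = 0, ‖s‖ < 1, and β ≤ d/(1 − ‖s‖²). Then the limiting exponential tilting function ψ^{β,h} has a unique global maximizing point (x*,y*) on B_{2d}(0,1), and d_BL1(μ_n^{β,h}, ν^{x*,y*,h}) → 0 as n → ∞. -/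

import Mathlib

open MeasureTheory Filter Topology

noncomputable def ip {d : ℕ} (x y : Fin d → ℝ) : ℝ := ∑ j, x j * y j

noncomputable def sampleMean (d : ℕ) (h : ℕ → Fin d → ℝ) (n : ℕ) : Fin d → ℝ :=
  fun j => (∑ i ∈ Finset.range n, h i j) / n

noncomputable def sampleStd (d : ℕ) (h : ℕ → Fin d → ℝ) (n : ℕ) : Fin d → ℝ :=
  fun j => Real.sqrt ((∑ i ∈ Finset.range n, (h i j) ^ 2) / n - (sampleMean d h n j) ^ 2)

/-- Membership in the open unit ball `B_{2d}(0,1) ⊂ ℝ^d × ℝ^d`. -/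
def inBall (d : ℕ) (x y : Fin d → ℝ) : Prop := ip x x + ip y y < 1

def ballSet (d : ℕ) : Set ((Fin d → ℝ) × (Fin d → ℝ)) := {p | inBall d p.1 p.2}

/-- The exponential tilting function with mean vector `m` and standard deviation vector `s`. -/
noncomputable def psi (d : ℕ) (β : ℝ) (m s : Fin d → ℝ) (x y : Fin d → ℝ) : ℝ :=
  β / 2 * ip x x + β * ip m x + β * ip s y + (d : ℝ) / 2 * Real.log (1 - ip x x - ip y y)
/-- The weight 2^{-(i+j)} for site i ∈ ℕ (counted from 1) and component j ∈ {1,…,d}. -/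
noncomputable def w (d : ℕ) (p : ℕ × Fin d) : ℝ :=
  ((1 : ℝ) / 2) ^ (p.1 + 1 + ((p.2 : ℕ) + 1))

/-- The normalizing constant C(d) = Σ_{(i,j)} 2^{-(i+j)}. -/
noncomputable def Cd (d : ℕ) : ℝ := ∑' p : ℕ × Fin d, w d p

/-- The metric on the configuration space (ℝ^d)^ℕ. -/
noncomputable def cfgDist (d : ℕ) (φ φ' : ℕ → Fin d → ℝ) : ℝ :=
  (Cd d)⁻¹ * ∑' p : ℕ × Fin d, w d p * min |φ p.1 p.2 - φ' p.1 p.2| 1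

/-- The bounded Lipschitz distance between probability measures on (ℝ^d)^ℕ. -/
noncomputable def blDistCfg (d : ℕ) (μ ν : Measure (ℕ → Fin d → ℝ)) : ℝ :=
  sSup {r : ℝ | ∃ f : (ℕ → Fin d → ℝ) → ℝ, (∀ φ, |f φ| ≤ 1) ∧
    (∀ φ φ', |f φ - f φ'| ≤ cfgDist d φ φ') ∧ r = |∫ φ, f φ ∂μ - ∫ φ, f φ ∂ν|}

/-- The Hamiltonian Hₙ^h(φ) = −(1/(2n)) Σ_{i,i'} ⟨φ(i),φ(i')⟩ − Σ_i ⟨h(i),φ(i)⟩. -/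
noncomputable def Hn (d n : ℕ) (h : ℕ → Fin d → ℝ) (φ : Fin n → Fin d → ℝ) : ℝ :=
  -(1 / (2 * (n : ℝ))) * ∑ i : Fin n, ∑ i' : Fin n, ip (φ i) (φ i') -
    ∑ i : Fin n, ip (h (i : ℕ)) (φ i)

/-- The finite-volume Gibbs state μₙ^{β,h}: the normalized measure on the sphere
√n·S^{nd−1} with Boltzmann weight e^{−βHₙ}, relative to the surface
((nd−1)-dimensional Hausdorff) measure, pushed to (ℝ^d)^ℕ by extending with 0. -/
noncomputable def gibbs (d n : ℕ) (β : ℝ) (h : ℕ → Fin d → ℝ) :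
    Measure (ℕ → Fin d → ℝ) :=
  let ρ : Measure (Metric.sphere (0 : EuclideanSpace ℝ (Fin n × Fin d)) 1) :=
    (μH[((n * d : ℕ) : ℝ) - 1]).withDensity fun Ωp =>
      ENNReal.ofReal (Real.exp (-β * Hn d n h fun i j =>
        Real.sqrt n * Ωp.val (i, j)))
  ((ρ Set.univ)⁻¹ • ρ).map fun Ωp (i : ℕ) (j : Fin d) =>
    if hi : i < n then Real.sqrt n * Ωp.val (⟨i, hi⟩, j) else 0

/-- `ν` is the product probability measure on (ℝ^d)^ℕ whose (i,j)-coordinate marginal is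
Gaussian with mean `mean i j` and variance `v`, characterized through its
finite-dimensional marginals. -/
def IsProdGaussian (d : ℕ) (mean : ℕ → Fin d → ℝ) (v : NNReal)
    (ν : Measure (ℕ → Fin d → ℝ)) : Prop :=
  IsProbabilityMeasure ν ∧
    ∀ n : ℕ, ν.map (fun φ (i : Fin n) => φ (i : ℕ)) =
      Measure.pi fun i : Fin n =>
        Measure.pi fun j : Fin d => ProbabilityTheory.gaussianReal (mean (i : ℕ) j) v

/-- The mean of the (i,j)-marginal of the product state ν^{x,y,h}. -/
noncomputable def pureMean (d : ℕ) (h : ℕ → Fin d → ℝ) (m s x y : Fin d → ℝ) :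
    ℕ → Fin d → ℝ :=
  fun i j => x j + y j * (h i j - m j) / s j

/-- The variance (1 − ‖x‖² − ‖y‖²)/d of the marginals of the product state ν^{x,y,h}. -/
noncomputable def pureVar (d : ℕ) (x y : Fin d → ℝ) : NNReal :=
  ((1 - ip x x - ip y y) / d).toNNReal

section RotationInvariant
variable {E : Type*} [NormedAddCommGroup E] [InnerProductSpace ℝ E] [FiniteDimensional ℝ E]
  [MeasurableSpace E] [BorelSpace E]

lemma charFun_eq_of_norm_eq {μ : Measure E} (hμ : ∀ e : E ≃ₗᵢ[ℝ] E, μ.map e = μ) {x y : E}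
    (hxy : ‖x‖ = ‖y‖) : charFun μ x = charFun μ y := by
  set e : E ≃ₗᵢ[ℝ] E := (ℝ ∙ (x - y))ᗮ.reflection with he
  have hex : e x = y := Submodule.reflection_sub hxy
  rw [charFun_apply, charFun_apply]
  conv_rhs => rw [← hμ e, integral_map (by fun_prop) (by fun_prop)]
  refine integral_congr_ae (ae_of_all _ fun z => ?_)
  simp only
  rw [← hex, e.inner_map_map]

/-- Two rotation invariant probability measures carried by the unit sphere coincide. -/
lemma rotInv_unique (μ ν : Measure E) [IsProbabilityMeasure μ] [IsProbabilityMeasure ν]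
    (hμ : ∀ e : E ≃ₗᵢ[ℝ] E, μ.map e = μ) (hν : ∀ e : E ≃ₗᵢ[ℝ] E, ν.map e = ν)
    (hμ1 : ∀ᵐ x ∂μ, ‖x‖ = 1) (hν1 : ∀ᵐ x ∂ν, ‖x‖ = 1) : μ = ν := by
  have key : ∀ (μ ν : Measure E) [IsProbabilityMeasure μ] [IsProbabilityMeasure ν],
      (∀ e : E ≃ₗᵢ[ℝ] E, μ.map e = μ) → (∀ᵐ x ∂ν, ‖x‖ = 1) → ∀ t : E,
      charFun μ t = ∫ ω, ∫ x, Complex.exp (inner ℝ x (‖t‖ • ω) * Complex.I) ∂μ ∂ν := by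
    intro μ ν _ _ hμ hν1 t
    have : ∀ᵐ ω ∂ν, ∫ x, Complex.exp (inner ℝ x (‖t‖ • ω) * Complex.I) ∂μ = charFun μ t := by
      filter_upwards [hν1] with ω hω
      rw [← charFun_apply]
      exact charFun_eq_of_norm_eq hμ (by simp [norm_smul, hω])
    rw [integral_congr_ae this]
    simp
  refine Measure.ext_of_charFun ?_
  ext t
  rw [key μ ν hμ hν1 t, key ν μ hν hμ1 t, integral_integral_swap]
  · simp only [inner_smul_right, real_inner_comm]
  · refine Integrable.of_bound (C := 1) (Continuous.aestronglyMeasurable (by fun_prop))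
      (ae_of_all _ fun p => ?_)
    simp [Function.uncurry, Complex.norm_exp]

end RotationInvariant

section HausdorffSphere
variable {ι : Type*} [Fintype ι]

lemma card_ne_cast [DecidableEq ι] (p₀ : ι) :
    ((Fintype.card {p : ι // p ≠ p₀} : ℕ) : ℝ) = (Fintype.card ι : ℝ) - 1 := by
  have h1 : Fintype.card {p : ι // p ≠ p₀} = Fintype.card ι - 1 := by
    rw [Fintype.card_subtype_compl, Fintype.card_subtype_eq]
  have h2 : 1 ≤ Fintype.card ι := Fintype.card_pos_iff.2 ⟨p₀⟩
  rw [h1, Nat.cast_sub h2, Nat.cast_one]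

lemma hausdorffMeasure_sphere_pos [Nonempty ι] :
    (μH[(Fintype.card ι : ℝ) - 1] :
      Measure (Metric.sphere (0 : EuclideanSpace ℝ ι) 1)) Set.univ ≠ 0 := by
  classical
  obtain ⟨p₀⟩ := ‹Nonempty ι›
  rw [← card_ne_cast p₀]
  let g : Metric.sphere (0 : EuclideanSpace ℝ ι) 1 → ({p : ι // p ≠ p₀} → ℝ) := fun x p => x.1 p
  have hg : LipschitzWith 1 g := by
    refine LipschitzWith.of_dist_le_mul fun x y => ?_
    rw [NNReal.coe_one, one_mul, dist_pi_le_iff dist_nonneg]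
    intro p
    rw [Subtype.dist_eq, dist_eq_norm x.1 y.1, Real.dist_eq, ← Real.norm_eq_abs]
    exact PiLp.norm_apply_le (x.1 - y.1) p.1
  have h1 := hg.hausdorffMeasure_image_le (d := (Fintype.card {p : ι // p ≠ p₀} : ℝ))
    (by positivity) Set.univ
  rw [hausdorffMeasure_pi_real] at h1
  intro h0
  rw [h0, mul_zero] at h1
  have hopen : IsOpen {y : {p : ι // p ≠ p₀} → ℝ | ∑ p, y p ^ 2 < 1} :=
    isOpen_lt (by fun_prop) continuous_const
  have hpos := hopen.measure_pos volume ⟨0, by simp⟩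
  refine absurd (hpos.trans_le ((measure_mono ?_).trans h1)) (lt_irrefl _)
  intro y hy
  have hy' : ∑ p, y p ^ 2 < 1 := hy
  let x : EuclideanSpace ℝ ι := WithLp.toLp 2 fun p =>
    if hp : p ≠ p₀ then y ⟨p, hp⟩ else Real.sqrt (1 - ∑ p, y p ^ 2)
  have hx : ‖x‖ = 1 := by
    rw [EuclideanSpace.norm_eq, Real.sqrt_eq_one, ← Fintype.sum_subtype_add_sum_subtype (· ≠ p₀)]
    have e1 : ∑ i : {p // p ≠ p₀}, ‖x i.1‖ ^ 2 = ∑ p, y p ^ 2 := by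
      refine Finset.sum_congr rfl fun i _ => ?_
      simp [x, i.2]
    have e2 : ∑ i : {p // ¬ p ≠ p₀}, ‖x i.1‖ ^ 2 = 1 - ∑ p, y p ^ 2 := by
      rw [Fintype.sum_eq_single ⟨p₀, by simp⟩]
      · simp [x, Real.sq_sqrt (sub_nonneg.2 hy'.le)]
      · rintro ⟨i, hi⟩ hne
        exact absurd (Subtype.ext (by simpa using hi)) hne
    rw [e1, e2]; ring
  refine ⟨⟨x, by simpa using hx⟩, trivial, ?_⟩
  ext p
  simp [g, x, p.2]

lemma norm_normalize_sub_le {F : Type*} [NormedAddCommGroup F] [NormedSpace ℝ F] {v w : F}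
    (hv : 1 ≤ ‖v‖) (hw : 1 ≤ ‖w‖) : ‖‖v‖⁻¹ • v - ‖w‖⁻¹ • w‖ ≤ 2 * ‖v - w‖ := by
  have hv0 : 0 < ‖v‖ := by linarith
  have hw0 : 0 < ‖w‖ := by linarith
  have : ‖v‖⁻¹ • v - ‖w‖⁻¹ • w = ‖v‖⁻¹ • (v - w) + (‖v‖⁻¹ * (‖w‖ - ‖v‖) * ‖w‖⁻¹) • w := by
    have e : ‖v‖⁻¹ * (‖w‖ - ‖v‖) * ‖w‖⁻¹ = ‖v‖⁻¹ - ‖w‖⁻¹ := by field_simp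
    rw [e]; module
  rw [this]
  have h1 : ‖‖v‖⁻¹ • (v - w)‖ ≤ ‖v - w‖ := by
    rw [norm_smul, norm_inv, norm_norm]
    exact mul_le_of_le_one_left (norm_nonneg _) (inv_le_one_of_one_le₀ hv)
  have h2 : ‖(‖v‖⁻¹ * (‖w‖ - ‖v‖) * ‖w‖⁻¹) • w‖ ≤ ‖v - w‖ := by
    rw [norm_smul, norm_mul, norm_mul, norm_inv, norm_inv, norm_norm, norm_norm, mul_assoc,
      inv_mul_cancel₀ hw0.ne', mul_one]
    refine (mul_le_of_le_one_left (norm_nonneg _) (inv_le_one_of_one_le₀ hv)).trans ?_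
    rw [norm_sub_rev]
    exact abs_norm_sub_norm_le v w
  linarith [norm_add_le (‖v‖⁻¹ • (v - w)) ((‖v‖⁻¹ * (‖w‖ - ‖v‖) * ‖w‖⁻¹) • w)]

lemma hausdorffMeasure_sphere_lt_top [Nonempty ι] :
    (μH[(Fintype.card ι : ℝ) - 1] :
      Measure (Metric.sphere (0 : EuclideanSpace ℝ ι) 1)) Set.univ < ⊤ := by
  classical
  have hd : (0 : ℝ) ≤ (Fintype.card ι : ℝ) - 1 := by
    have : 1 ≤ Fintype.card ι := Fintype.card_pos
    have : (1 : ℝ) ≤ Fintype.card ι := by exact_mod_cast this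
    linarith
  have hiso : Isometry (Subtype.val : Metric.sphere (0 : EuclideanSpace ℝ ι) 1 → _) :=
    isometry_subtype_coe
  rw [← hiso.hausdorffMeasure_image (Or.inl hd)]
  let ext : (p₀ : ι) → ({p : ι // p ≠ p₀} → ℝ) →ₗ[ℝ] EuclideanSpace ℝ ι := fun p₀ =>
    (WithLp.linearEquiv 2 ℝ (ι → ℝ)).symm.toLinearMap ∘ₗ
      { toFun := fun y p => if hp : p ≠ p₀ then y ⟨p, hp⟩ else 0
        map_add' := by intro x y; ext p; by_cases hp : p = p₀ <;> simp [hp]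
        map_smul' := by intro c y; ext p; by_cases hp : p = p₀ <;> simp [hp] }
  have hext : ∀ p₀ y p, ext p₀ y p = if hp : p ≠ p₀ then y ⟨p, hp⟩ else 0 := fun _ _ _ => rfl
  let v : (p₀ : ι) → Bool → ({p : ι // p ≠ p₀} → ℝ) → EuclideanSpace ℝ ι := fun p₀ b y =>
    EuclideanSpace.single p₀ (if b then 1 else -1) + ext p₀ y
  have hv1 : ∀ p₀ b y, 1 ≤ ‖v p₀ b y‖ := by
    intro p₀ b y
    refine le_trans ?_ (PiLp.norm_apply_le (v p₀ b y) p₀)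
    cases b <;> simp [v, hext]
  let F : (q : ι × Bool) → ({p : ι // p ≠ q.1} → ℝ) → EuclideanSpace ℝ ι := fun q y =>
    ‖v q.1 q.2 y‖⁻¹ • v q.1 q.2 y
  have hF : ∀ q, ∃ K, LipschitzWith K (F q) := by
    rintro ⟨p₀, b⟩
    let L := (ext p₀).toContinuousLinearMap
    refine ⟨2 * ‖L‖₊, LipschitzWith.of_dist_le_mul fun y y' => ?_⟩
    rw [dist_eq_norm, dist_eq_norm]
    refine (norm_normalize_sub_le (hv1 p₀ b y) (hv1 p₀ b y')).trans ?_
    have : v p₀ b y - v p₀ b y' = L (y - y') := by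
      simp [v, L]
    rw [this]
    have := L.le_opNorm (y - y')
    push_cast
    linarith
  have hcover : (Subtype.val : Metric.sphere (0 : EuclideanSpace ℝ ι) 1 → _) '' Set.univ ⊆
      ⋃ q : ι × Bool, F q '' Metric.closedBall 0 1 := by
    rintro _ ⟨⟨x, hx⟩, -, rfl⟩
    have hx : ‖x‖ = 1 := by simpa using hx
    obtain ⟨p₀, hp₀⟩ := Finite.exists_max (fun p => |x p|)
    have hne : x p₀ ≠ 0 := by
      intro h0
      have : x = 0 := by
        ext p
        have := hp₀ p
        rw [h0, abs_zero] at this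
        simpa using this
      simp [this] at hx
    have hpos : 0 < |x p₀| := abs_pos.2 hne
    refine Set.mem_iUnion.2 ⟨(p₀, decide (0 < x p₀)), fun p => x p / |x p₀|, ?_, ?_⟩
    · rw [mem_closedBall_zero_iff, pi_norm_le_iff_of_nonneg zero_le_one]
      intro p
      rw [norm_div, Real.norm_eq_abs, Real.norm_eq_abs, abs_abs]
      exact div_le_one_of_le₀ (hp₀ p) hpos.le
    · have : v p₀ (decide (0 < x p₀)) (fun p => x p / |x p₀|) = |x p₀|⁻¹ • x := by
        ext p
        by_cases hp : p = p₀
        · subst hp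
          rcases lt_or_gt_of_ne hne with h | h
          · simp [v, hext, not_lt.2 h.le, abs_of_neg h, inv_neg, hne]
          · simp [v, hext, h, abs_of_pos h, hne]
        · simp [v, hext, hp, div_eq_inv_mul]
      simp only [F, this, norm_smul, norm_inv, Real.norm_eq_abs, abs_abs, hx, mul_one,
        inv_inv, smul_smul, mul_inv_cancel₀ hpos.ne', one_smul]
  refine (measure_mono hcover).trans_lt ?_
  refine (measure_iUnion_le _).trans_lt ?_
  rw [tsum_fintype]
  refine ENNReal.sum_lt_top.2 fun q _ => ?_
  obtain ⟨K, hK⟩ := hF q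
  refine (hK.hausdorffMeasure_image_le hd _).trans_lt ?_
  rw [← card_ne_cast q.1, hausdorffMeasure_pi_real]
  exact ENNReal.mul_lt_top (ENNReal.rpow_lt_top_of_nonneg (by positivity) ENNReal.coe_ne_top)
    (isCompact_closedBall _ _).measure_lt_top

end HausdorffSphere

section Cone

/-- The squared Euclidean length of a tuple. -/
noncomputable def sqLen {κ : Type*} [Fintype κ] (a : κ → ℝ) : ℝ := ∑ k, a k ^ 2

lemma sqLen_nonneg {κ : Type*} [Fintype κ] (a : κ → ℝ) : 0 ≤ sqLen a :=
  Finset.sum_nonneg fun _ _ => sq_nonneg _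

lemma sqLen_smul {κ : Type*} [Fintype κ] (r : ℝ) (a : κ → ℝ) :
    sqLen (r • a) = r ^ 2 * sqLen a := by
  simp [sqLen, mul_pow, Finset.mul_sum]

lemma sqLen_pos {κ : Type*} [Fintype κ] {a : κ → ℝ} (ha : a ≠ 0) : 0 < sqLen a := by
  obtain ⟨k, hk⟩ := Function.ne_iff.1 ha
  exact Finset.sum_pos' (fun _ _ => sq_nonneg _) ⟨k, Finset.mem_univ _, by
    have : a k ≠ 0 := hk
    positivity⟩

@[fun_prop]
lemma continuous_sqLen {κ : Type*} [Fintype κ] : Continuous (sqLen : (κ → ℝ) → ℝ) := by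
  unfold sqLen; fun_prop

@[fun_prop]
lemma measurable_sqLen {κ : Type*} [Fintype κ] : Measurable (sqLen : (κ → ℝ) → ℝ) :=
  continuous_sqLen.measurable

lemma pi_gaussian_eq_withDensity (ι : Type*) [Fintype ι] :
    Measure.pi (fun _ : ι => ProbabilityTheory.gaussianReal 0 1) =
      (volume : Measure (ι → ℝ)).withDensity fun w =>
        ENNReal.ofReal (((√(2 * Real.pi))⁻¹) ^ Fintype.card ι * Real.exp (-(sqLen w / 2))) := by
  symm
  have hprod : ∀ w : ι → ℝ, ((√(2 * Real.pi))⁻¹) ^ Fintype.card ι * Real.exp (-(sqLen w / 2)) =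
      ∏ i, ProbabilityTheory.gaussianPDFReal 0 1 (w i) := by
    intro w
    simp [ProbabilityTheory.gaussianPDFReal, Finset.prod_mul_distrib, ← Real.exp_sum, sqLen,
      Finset.sum_div, neg_div]
  simp_rw [hprod]
  refine (Measure.pi_eq fun s hs => ?_).symm
  rw [withDensity_apply _ (MeasurableSet.univ_pi hs), volume_pi, Measure.restrict_pi_pi,
    ← ofReal_integral_eq_lintegral_ofReal, integral_fintype_prod_eq_prod
      (fun _ => ProbabilityTheory.gaussianPDFReal 0 1), ENNReal.ofReal_prod_of_nonneg]
  · refine Finset.prod_congr rfl fun i _ => ?_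
    rw [ProbabilityTheory.gaussianReal_apply_eq_integral _ one_ne_zero]
  · exact fun i _ => integral_nonneg fun x => ProbabilityTheory.gaussianPDFReal_nonneg _ _ _
  · exact Integrable.fintype_prod fun i =>
      (ProbabilityTheory.integrable_gaussianPDFReal 0 1).integrableOn
  · exact ae_of_all _ fun w => Finset.prod_nonneg fun i _ =>
      ProbabilityTheory.gaussianPDFReal_nonneg _ _ _

lemma lintegral_eq_mul_lintegral_comp_smul {V : Type*} [NormedAddCommGroup V] [NormedSpace ℝ V]
    [FiniteDimensional ℝ V] [MeasurableSpace V] [BorelSpace V] (μ : Measure V) [μ.IsAddHaarMeasure]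
    {r : ℝ} (hr : 0 < r) {g : V → ENNReal} (hg : Measurable g) :
    ∫⁻ x, g x ∂μ = ENNReal.ofReal (r ^ Module.finrank ℝ V) * ∫⁻ x, g (r • x) ∂μ := by
  have h1 : ∫⁻ x, g (r • x) ∂μ = ∫⁻ x, g x ∂(μ.map (r • ·)) :=
    (lintegral_map hg (measurable_const_smul r)).symm
  have hp : 0 < r ^ Module.finrank ℝ V := pow_pos hr _
  rw [h1, Measure.map_addHaar_smul μ hr.ne', lintegral_smul_measure, smul_eq_mul, ← mul_assoc,
    ← ENNReal.ofReal_mul hp.le, abs_of_pos (inv_pos.2 hp), mul_inv_cancel₀ hp.ne',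
    ENNReal.ofReal_one, one_mul]

variable {E : Type*} [NormedAddCommGroup E] [InnerProductSpace ℝ E] {κ l : Type*}
  [Fintype κ] [Fintype l]

/-- The vector with given coordinates in an orthonormal basis indexed by a sum type. -/
noncomputable def sumVec (b : OrthonormalBasis (κ ⊕ l) ℝ E) (p : (κ → ℝ) × (l → ℝ)) : E :=
  ∑ k, p.1 k • b (Sum.inl k) + ∑ k, p.2 k • b (Sum.inr k)

lemma sumVec_eq (b : OrthonormalBasis (κ ⊕ l) ℝ E) (p : (κ → ℝ) × (l → ℝ)) :
    sumVec b p = b.repr.symm (WithLp.toLp 2 (Sum.elim p.1 p.2)) := by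
  rw [← b.sum_repr_symm]
  simp [sumVec]

lemma norm_sumVec_sq (b : OrthonormalBasis (κ ⊕ l) ℝ E) (p : (κ → ℝ) × (l → ℝ)) :
    ‖sumVec b p‖ ^ 2 = sqLen p.1 + sqLen p.2 := by
  rw [sumVec_eq, LinearIsometryEquiv.norm_map, EuclideanSpace.real_norm_sq_eq]
  simp [sqLen]

lemma sumVec_smul (b : OrthonormalBasis (κ ⊕ l) ℝ E) (r : ℝ) (p : (κ → ℝ) × (l → ℝ)) :
    sumVec b (r • p) = r • sumVec b p := by
  simp [sumVec, smul_add, Finset.smul_sum, smul_smul]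

@[fun_prop]
lemma continuous_sumVec (b : OrthonormalBasis (κ ⊕ l) ℝ E) : Continuous (sumVec b) := by
  unfold sumVec; fun_prop

/-- The point of the unit sphere with central-projection parameter `p.1` and direction `p.2` in
the complementary coordinates. -/
noncomputable def coneVec (b : OrthonormalBasis (κ ⊕ l) ℝ E) (p : (κ → ℝ) × (l → ℝ)) : E :=
  (√(1 + sqLen p.1))⁻¹ • sumVec b (p.1, (√(sqLen p.2))⁻¹ • p.2)

lemma coneVec_smul_right (b : OrthonormalBasis (κ ⊕ l) ℝ E) {t : ℝ} (ht : 0 < t) (a : κ → ℝ)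
    (w : l → ℝ) : coneVec b (a, t • w) = coneVec b (a, w) := by
  have : (√(sqLen (t • w)))⁻¹ • t • w = (√(sqLen w))⁻¹ • w := by
    rw [sqLen_smul, Real.sqrt_mul (sq_nonneg t), Real.sqrt_sq ht.le, smul_smul, mul_inv,
      mul_right_comm, inv_mul_cancel₀ ht.ne', one_mul]
  simp only [coneVec, this]

lemma normalize_sumVec (b : OrthonormalBasis (κ ⊕ l) ℝ E) (a : κ → ℝ) {w : l → ℝ} (hw : w ≠ 0) :
    ‖sumVec b (√(sqLen w) • a, w)‖ = √(sqLen w) * √(1 + sqLen a) ∧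
    ‖sumVec b (√(sqLen w) • a, w)‖⁻¹ • sumVec b (√(sqLen w) • a, w) = coneVec b (a, w) := by
  have hp := sqLen_pos hw
  have hr : 0 < √(sqLen w) := Real.sqrt_pos.2 hp
  have h1 : ‖sumVec b (√(sqLen w) • a, w)‖ = √(sqLen w) * √(1 + sqLen a) := by
    rw [← Real.sqrt_mul hp.le, ← Real.sqrt_sq (norm_nonneg (sumVec b _)), norm_sumVec_sq]
    simp only [sqLen_smul, Real.sq_sqrt hp.le]
    ring_nf
  refine ⟨h1, ?_⟩
  have h2 : (√(sqLen w) • a, w) = √(sqLen w) • (a, (√(sqLen w))⁻¹ • w) := by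
    rw [Prod.smul_mk, smul_smul, mul_inv_cancel₀ hr.ne', one_smul]
  rw [h1, h2, sumVec_smul, smul_smul, mul_inv, mul_right_comm, inv_mul_cancel₀ hr.ne', one_mul]
  rfl

variable [FiniteDimensional ℝ E] [MeasurableSpace E] [BorelSpace E]

lemma measurePreserving_sumVec (b : OrthonormalBasis (κ ⊕ l) ℝ E) :
    MeasurePreserving (sumVec b) volume volume := by
  have h := (b.measurePreserving_repr_symm.comp (PiLp.volume_preserving_toLp (κ ⊕ l))).comp
    (volume_measurePreserving_sumPiEquivProdPi_symm (fun _ : κ ⊕ l => ℝ))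
  convert! h using 1
  ext1 p
  rw [sumVec_eq]
  rfl

@[fun_prop]
lemma measurable_coneVec (b : OrthonormalBasis (κ ⊕ l) ℝ E) : Measurable (coneVec b) := by
  unfold coneVec
  have h2 := (continuous_sumVec b).measurable
  fun_prop

lemma lintegral_normalize [Nonempty l] (b : OrthonormalBasis (κ ⊕ l) ℝ E) {f : E → ENNReal}
    (hf : Measurable f) :
    ∫⁻ x, f (‖x‖⁻¹ • x) *
        ENNReal.ofReal ((‖x‖ ^ Fintype.card κ)⁻¹ * Real.exp (-(‖x‖ ^ 2 / 2))) =
      ∫⁻ a : κ → ℝ, ENNReal.ofReal ((√(1 + sqLen a) ^ (Fintype.card κ + Fintype.card l))⁻¹) *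
        ∫⁻ w : l → ℝ, f (coneVec b (a, w)) * ENNReal.ofReal (Real.exp (-(sqLen w / 2))) := by
  have hm : Measurable fun x : E => f (‖x‖⁻¹ • x) *
        ENNReal.ofReal ((‖x‖ ^ Fintype.card κ)⁻¹ * Real.exp (-(‖x‖ ^ 2 / 2))) := by fun_prop
  have hsv := (continuous_sumVec b).measurable
  rw [← (measurePreserving_sumVec b).lintegral_comp hm, Measure.volume_eq_prod]
  refine (lintegral_prod_symm' _ (hm.comp hsv)).trans ?_
  have step1 : ∀ᵐ w : l → ℝ, ∫⁻ Z : κ → ℝ, f (‖sumVec b (Z, w)‖⁻¹ • sumVec b (Z, w)) *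
        ENNReal.ofReal ((‖sumVec b (Z, w)‖ ^ Fintype.card κ)⁻¹ *
          Real.exp (-(‖sumVec b (Z, w)‖ ^ 2 / 2))) =
      ∫⁻ a : κ → ℝ, f (coneVec b (a, w)) * ENNReal.ofReal ((√(1 + sqLen a) ^ Fintype.card κ)⁻¹ *
          Real.exp (-(sqLen w * (1 + sqLen a) / 2))) := by
    have hne : ∀ᵐ w : l → ℝ, w ≠ 0 := compl_mem_ae_iff.2 (measure_singleton 0)
    filter_upwards [hne] with w hw
    have hp := sqLen_pos hw
    have hr : 0 < √(sqLen w) := Real.sqrt_pos.2 hp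
    refine (lintegral_eq_mul_lintegral_comp_smul volume hr
      (hm.comp (hsv.comp (measurable_id.prodMk measurable_const)))).trans ?_
    rw [← lintegral_const_mul' _ _ ENNReal.ofReal_ne_top]
    refine lintegral_congr fun a => ?_
    obtain ⟨e1, e2⟩ := normalize_sumVec b a hw
    simp only [Function.comp_apply, id_eq, e2]
    rw [e1, mul_left_comm, ← ENNReal.ofReal_mul (by positivity), Module.finrank_fintype_fun_eq_card]
    have h1 : 0 < √(1 + sqLen a) := Real.sqrt_pos.2 (by linarith [sqLen_nonneg a])
    congr 2
    rw [mul_pow (√(sqLen w)) _ 2, Real.sq_sqrt hp.le, Real.sq_sqrt (by linarith [sqLen_nonneg a]),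
      mul_pow, ← mul_assoc]
    congr 1
    field_simp
  have hm2 : Measurable fun p : (l → ℝ) × (κ → ℝ) => f (coneVec b (p.2, p.1)) *
      ENNReal.ofReal ((√(1 + sqLen p.2) ^ Fintype.card κ)⁻¹ *
          Real.exp (-(sqLen p.1 * (1 + sqLen p.2) / 2))) := by
    have := (measurable_coneVec b)
    fun_prop
  refine (lintegral_congr_ae step1).trans ?_
  rw [lintegral_lintegral_swap hm2.aemeasurable]
  refine lintegral_congr fun a => ?_
  have hs : 0 < 1 + sqLen a := by linarith [sqLen_nonneg a]
  have ht : 0 < √(1 + sqLen a) := Real.sqrt_pos.2 hs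
  refine (lintegral_eq_mul_lintegral_comp_smul volume (inv_pos.2 ht)
    (hm2.comp (measurable_id.prodMk measurable_const))).trans ?_
  rw [← lintegral_const_mul' _ _ ENNReal.ofReal_ne_top,
    ← lintegral_const_mul' _ _ ENNReal.ofReal_ne_top]
  refine lintegral_congr fun w => ?_
  simp only [Function.comp_apply, id_eq]
  rw [coneVec_smul_right b (inv_pos.2 ht), mul_left_comm, mul_left_comm (ENNReal.ofReal _) (f _),
    ← ENNReal.ofReal_mul (by positivity), ← ENNReal.ofReal_mul (by positivity),
    Module.finrank_fintype_fun_eq_card]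
  congr 2
  rw [sqLen_smul, inv_pow (√(1 + sqLen a)) 2, Real.sq_sqrt hs.le, ← mul_assoc, inv_pow, ← mul_inv,
    ← pow_add, add_comm (Fintype.card l)]
  congr 2
  field_simp

end Cone

section Proportional
variable {E : Type*} [NormedAddCommGroup E] [InnerProductSpace ℝ E] [FiniteDimensional ℝ E]
  [MeasurableSpace E] [BorelSpace E]

lemma rotInv_proportional (μ ν : Measure E) [IsFiniteMeasure μ] [IsFiniteMeasure ν]
    (hμ0 : μ ≠ 0) (hν0 : ν ≠ 0)
    (hμ : ∀ e : E ≃ₗᵢ[ℝ] E, μ.map e = μ) (hν : ∀ e : E ≃ₗᵢ[ℝ] E, ν.map e = ν)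
    (hμ1 : ∀ᵐ x ∂μ, ‖x‖ = 1) (hν1 : ∀ᵐ x ∂ν, ‖x‖ = 1) :
    ∃ c : ENNReal, c ≠ 0 ∧ c ≠ ⊤ ∧ μ = c • ν := by
  have : NeZero μ := ⟨hμ0⟩
  have : NeZero ν := ⟨hν0⟩
  have h := rotInv_unique ((μ Set.univ)⁻¹ • μ) ((ν Set.univ)⁻¹ • ν)
    (fun e => by rw [Measure.map_smul, hμ]) (fun e => by rw [Measure.map_smul, hν])
    (Measure.ae_smul_measure hμ1 _) (Measure.ae_smul_measure hν1 _)
  have h0 : μ Set.univ ≠ 0 := NeZero.ne _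
  have h0' : ν Set.univ ≠ 0 := NeZero.ne _
  have ht : μ Set.univ ≠ ⊤ := measure_ne_top _ _
  have ht' : ν Set.univ ≠ ⊤ := measure_ne_top _ _
  refine ⟨μ Set.univ * (ν Set.univ)⁻¹, mul_ne_zero h0 (ENNReal.inv_ne_zero.2 ht'),
    ENNReal.mul_ne_top ht (ENNReal.inv_ne_top.2 h0'), ?_⟩
  rw [← smul_smul, ← h, smul_smul, ENNReal.mul_inv_cancel h0 ht, one_smul]

end Proportional

section ConeMeasure

/-- The image of the uniform measure under central projection, as a measure on the parameters. -/
noncomputable def coneDensity (κ : Type*) [Fintype κ] (N : ℕ) : Measure (κ → ℝ) :=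
  volume.withDensity fun a => ENNReal.ofReal ((√(1 + sqLen a) ^ N)⁻¹)

variable {κ l : Type*} [Fintype κ] [Fintype l]

lemma norm_sq_le_sqLen (a : κ → ℝ) : ‖a‖ ^ 2 ≤ sqLen a := by
  have h : ‖a‖ ≤ √(sqLen a) := by
    refine (pi_norm_le_iff_of_nonneg (Real.sqrt_nonneg _)).2 fun k => ?_
    refine Real.le_sqrt_of_sq_le ?_
    rw [Real.norm_eq_abs, sq_abs]
    exact Finset.single_le_sum (f := fun k => a k ^ 2) (fun _ _ => sq_nonneg _) (Finset.mem_univ k)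
  calc ‖a‖ ^ 2 ≤ √(sqLen a) ^ 2 := by gcongr
    _ = sqLen a := Real.sq_sqrt (sqLen_nonneg a)

lemma integrable_inv_sqrt_pow {N : ℕ} (hN : Fintype.card κ < N) :
    Integrable fun a : κ → ℝ => (√(1 + sqLen a) ^ N)⁻¹ := by
  have h : Integrable fun a : κ → ℝ => (1 + ‖a‖ ^ 2) ^ (-(N : ℝ) / 2) := by
    refine integrable_rpow_neg_one_add_norm_sq ?_
    rw [Module.finrank_fintype_fun_eq_card]
    exact_mod_cast hN
  refine h.mono' (by fun_prop) (ae_of_all _ fun a => ?_)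
  have h1 : 0 < 1 + ‖a‖ ^ 2 := by positivity
  rw [Real.norm_of_nonneg (by positivity), neg_div, Real.rpow_neg h1.le, Real.sqrt_eq_rpow,
    ← Real.rpow_natCast, ← Real.rpow_mul (by linarith [sqLen_nonneg a])]
  have h2 : 1 / 2 * (N : ℝ) = N / 2 := by ring
  rw [h2]
  refine inv_anti₀ (by positivity) (Real.rpow_le_rpow h1.le ?_ (by positivity))
  linarith [norm_sq_le_sqLen a]

lemma isFiniteMeasure_coneDensity {N : ℕ} (hN : Fintype.card κ < N) :
    IsFiniteMeasure (coneDensity κ N) :=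
  isFiniteMeasure_withDensity_ofReal (integrable_inv_sqrt_pow hN).2

lemma coneDensity_ne_zero (N : ℕ) : coneDensity κ N ≠ 0 := by
  intro h
  rw [coneDensity, withDensity_eq_zero_iff (by fun_prop)] at h
  have h2 : ∀ᵐ a : κ → ℝ, False := by
    filter_upwards [h] with a ha
    have h1 : 0 < √(1 + sqLen a) := Real.sqrt_pos.2 (by linarith [sqLen_nonneg a])
    have : 0 < (√(1 + sqLen a) ^ N)⁻¹ := by positivity
    rw [Pi.zero_apply, ENNReal.ofReal_eq_zero] at ha
    linarith
  rw [ae_iff] at h2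
  simp only [not_false_eq_true, Set.ofPred_true] at h2
  exact isOpen_univ.measure_ne_zero volume Set.univ_nonempty h2

variable {E : Type*} [NormedAddCommGroup E] [InnerProductSpace ℝ E] [FiniteDimensional ℝ E]
  [MeasurableSpace E] [BorelSpace E]

/-- The uniform measure on the sphere (up to a constant) in central-projection coordinates. -/
noncomputable def coneMeasure (b : OrthonormalBasis (κ ⊕ l) ℝ E) : Measure E :=
  ((coneDensity κ (Fintype.card κ + Fintype.card l)).prod
    (Measure.pi fun _ : l => ProbabilityTheory.gaussianReal 0 1)).map (coneVec b)

lemma lintegral_coneMeasure [Nonempty l] (b : OrthonormalBasis (κ ⊕ l) ℝ E) {f : E → ENNReal}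
    (hf : Measurable f) :
    ∫⁻ x, f x ∂(coneMeasure b) = ENNReal.ofReal (((√(2 * Real.pi))⁻¹) ^ Fintype.card l) *
      ∫⁻ x, f (‖x‖⁻¹ • x) *
        ENNReal.ofReal ((‖x‖ ^ Fintype.card κ)⁻¹ * Real.exp (-(‖x‖ ^ 2 / 2))) := by
  have hc := measurable_coneVec b
  have hm : Measurable fun p : (κ → ℝ) × (l → ℝ) => f (coneVec b p) := hf.comp hc
  rw [coneMeasure, lintegral_map hf hc, lintegral_prod _ hm.aemeasurable, coneDensity,
    lintegral_withDensity_eq_lintegral_mul _ (by fun_prop) hm.lintegral_prod_right',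
    lintegral_normalize b hf, ← lintegral_const_mul' _ _ ENNReal.ofReal_ne_top]
  refine lintegral_congr fun a => ?_
  have hma : Measurable fun w : l → ℝ => f (coneVec b (a, w)) :=
    hm.comp (measurable_const.prodMk measurable_id)
  rw [Pi.mul_apply, mul_left_comm, pi_gaussian_eq_withDensity,
    lintegral_withDensity_eq_lintegral_mul _ (by fun_prop) hma]
  congr 1
  rw [← lintegral_const_mul' _ _ ENNReal.ofReal_ne_top]
  refine lintegral_congr fun w => ?_
  rw [Pi.mul_apply, ENNReal.ofReal_mul (by positivity), mul_assoc,
    mul_comm (ENNReal.ofReal (Real.exp _))]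

lemma isFiniteMeasure_coneMeasure [Nonempty l] (b : OrthonormalBasis (κ ⊕ l) ℝ E) :
    IsFiniteMeasure (coneMeasure b) := by
  have : IsFiniteMeasure (coneDensity κ (Fintype.card κ + Fintype.card l)) :=
    isFiniteMeasure_coneDensity (by have := Fintype.card_pos (α := l); omega)
  unfold coneMeasure
  infer_instance

lemma coneMeasure_ne_zero [Nonempty l] (b : OrthonormalBasis (κ ⊕ l) ℝ E) :
    coneMeasure b ≠ 0 := by
  have : IsFiniteMeasure (coneDensity κ (Fintype.card κ + Fintype.card l)) :=
    isFiniteMeasure_coneDensity (by have := Fintype.card_pos (α := l); omega)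
  intro h
  have h1 : coneMeasure b Set.univ = 0 := by simp [h]
  rw [coneMeasure, Measure.map_apply (measurable_coneVec b) MeasurableSet.univ, Set.preimage_univ,
    ← Set.univ_prod_univ, Measure.prod_prod,
    measure_univ (μ := Measure.pi fun _ : l => ProbabilityTheory.gaussianReal 0 1), mul_one,
    Measure.measure_univ_eq_zero] at h1
  exact coneDensity_ne_zero _ h1

lemma map_coneMeasure [Nonempty l] (b : OrthonormalBasis (κ ⊕ l) ℝ E) (e : E ≃ₗᵢ[ℝ] E) :
    (coneMeasure b).map e = coneMeasure b := by
  refine Measure.ext_of_lintegral _ fun f hf => ?_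
  have he : Measurable e := e.continuous.measurable
  rw [lintegral_map hf he, lintegral_coneMeasure b hf, lintegral_coneMeasure b (f := fun x => f (e x)) (hf.comp he)]
  congr 1
  have hm : Measurable fun x : E => f (‖x‖⁻¹ • x) *
        ENNReal.ofReal ((‖x‖ ^ Fintype.card κ)⁻¹ * Real.exp (-(‖x‖ ^ 2 / 2))) := by fun_prop
  rw [← e.measurePreserving.lintegral_comp hm]
  simp

lemma ae_norm_coneMeasure [Nonempty l] (b : OrthonormalBasis (κ ⊕ l) ℝ E) :
    ∀ᵐ x ∂(coneMeasure b), ‖x‖ = 1 := by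
  have hs : MeasurableSet {x : E | ‖x‖ ≠ 1} :=
    (isClosed_eq continuous_norm continuous_const).isOpen_compl.measurableSet
  have h : ∫⁻ x, Set.indicator {x : E | ‖x‖ ≠ 1} 1 x ∂(coneMeasure b) = 0 := by
    rw [lintegral_coneMeasure b (measurable_one.indicator hs)]
    refine mul_eq_zero_of_right _ ?_
    have : ∀ᵐ x : E, Set.indicator {x : E | ‖x‖ ≠ 1} (1 : E → ENNReal) (‖x‖⁻¹ • x) *
        ENNReal.ofReal ((‖x‖ ^ Fintype.card κ)⁻¹ * Real.exp (-(‖x‖ ^ 2 / 2))) = 0 := by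
      have : Nontrivial E := by
        have hb := b.toBasis
        obtain ⟨i⟩ := ‹Nonempty l›
        exact ⟨b (Sum.inr i), 0, b.orthonormal.ne_zero _⟩
      have hne : ∀ᵐ x : E, x ≠ 0 := compl_mem_ae_iff.2 (measure_singleton 0)
      filter_upwards [hne] with x hx
      refine mul_eq_zero_of_left (Set.indicator_of_notMem ?_ _) _
      simp [norm_smul, hx]
    rw [lintegral_congr_ae this, lintegral_zero]
  rwa [lintegral_indicator_one hs] at h

lemma map_val_hausdorffMeasure_sphere {ι : Type*} [Fintype ι] [Nonempty ι] [Nonempty l]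
    (b : OrthonormalBasis (κ ⊕ l) ℝ (EuclideanSpace ℝ ι)) :
    ∃ c : ENNReal, c ≠ 0 ∧ c ≠ ⊤ ∧
      (μH[(Fintype.card ι : ℝ) - 1] :
        Measure (Metric.sphere (0 : EuclideanSpace ℝ ι) 1)).map Subtype.val =
        c • coneMeasure b := by
  have hv : Measurable (Subtype.val : Metric.sphere (0 : EuclideanSpace ℝ ι) 1 → _) :=
    measurable_subtype_coe
  have : IsFiniteMeasure (μH[(Fintype.card ι : ℝ) - 1] :
        Measure (Metric.sphere (0 : EuclideanSpace ℝ ι) 1)) := ⟨hausdorffMeasure_sphere_lt_top⟩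
  have := isFiniteMeasure_coneMeasure b
  refine rotInv_proportional _ _ ?_ (coneMeasure_ne_zero b) ?_ (map_coneMeasure b) ?_
    (ae_norm_coneMeasure b)
  · intro h
    rw [Measure.map_eq_zero_iff hv.aemeasurable] at h
    exact hausdorffMeasure_sphere_pos (ι := ι) (by simp [h])
  · intro e
    let e' : Metric.sphere (0 : EuclideanSpace ℝ ι) 1 ≃ᵢ Metric.sphere (0 : EuclideanSpace ℝ ι) 1 :=
      { toFun := fun x => ⟨e x.1, by simp⟩
        invFun := fun x => ⟨e.symm x.1, by simp⟩
        left_inv := fun x => by simp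
        right_inv := fun x => by simp
        isometry_toFun := fun x y => e.isometry.edist_eq x.1 y.1 }
    conv_rhs => rw [← e'.map_hausdorffMeasure]
    rw [Measure.map_map e.continuous.measurable hv,
      Measure.map_map hv e'.continuous.measurable]
    rfl
  · rw [ae_map_iff hv.aemeasurable (isClosed_eq continuous_norm continuous_const).measurableSet]
    exact ae_of_all _ fun x => by simp

end ConeMeasure

section Optimization

variable {d : ℕ}

lemma ip_comm (a b : Fin d → ℝ) : ip a b = ip b a := by
  simp [ip, mul_comm]

lemma ip_sub_left (a b c : Fin d → ℝ) : ip (a - b) c = ip a c - ip b c := by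
  simp [ip, sub_mul, Finset.sum_sub_distrib]

lemma ip_sub_right (a b c : Fin d → ℝ) : ip a (b - c) = ip a b - ip a c := by
  rw [ip_comm, ip_sub_left, ip_comm b, ip_comm c]

lemma ip_smul_left (r : ℝ) (a b : Fin d → ℝ) : ip (r • a) b = r * ip a b := by
  simp [ip, mul_assoc, Finset.mul_sum]

lemma ip_smul_right (r : ℝ) (a b : Fin d → ℝ) : ip a (r • b) = r * ip a b := by
  rw [ip_comm, ip_smul_left, ip_comm]

lemma ip_self_nonneg (a : Fin d → ℝ) : 0 ≤ ip a a :=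
  Finset.sum_nonneg fun _ _ => mul_self_nonneg _

lemma ip_self_eq_zero {a : Fin d → ℝ} : ip a a = 0 ↔ a = 0 := by
  constructor
  · intro h
    rw [ip, Finset.sum_eq_zero_iff_of_nonneg fun _ _ => mul_self_nonneg _] at h
    ext j
    simpa using h j (Finset.mem_univ j)
  · rintro rfl
    simp [ip]

lemma ip_self_pos {a : Fin d → ℝ} (ha : a ≠ 0) : 0 < ip a a :=
  (ip_self_nonneg a).lt_of_ne fun h => ha (ip_self_eq_zero.1 h.symm)

lemma psi_sub_psi {β u : ℝ} {m s x y : Fin d → ℝ} (hu : 0 < u)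
    (hx : ((d : ℝ) / u - β) • x = β • m) (hy : ((d : ℝ) / u) • y = β • s)
    (huxy : 1 - ip x x - ip y y = u) {x' y' : Fin d → ℝ} (h' : inBall d x' y') :
    psi d β m s x y - psi d β m s x' y' =
      ((d : ℝ) / u - β) / 2 * ip (x' - x) (x' - x) + (d : ℝ) / u / 2 * ip (y' - y) (y' - y) +
        (d : ℝ) / 2 * ((1 - ip x' x' - ip y' y') / u - 1 -
          Real.log ((1 - ip x' x' - ip y' y') / u)) := by
  have hv : 0 < 1 - ip x' x' - ip y' y' := by unfold inBall at h'; linarith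
  have e (z : Fin d → ℝ) : ((d : ℝ) / u - β) * ip x z = β * ip m z := by
    rw [← ip_smul_left, hx, ip_smul_left]
  have e' (z : Fin d → ℝ) : ((d : ℝ) / u) * ip y z = β * ip s z := by
    rw [← ip_smul_left, hy, ip_smul_left]
  have h3 : (d : ℝ) / 2 * ((1 - ip x' x' - ip y' y') / u - 1) =
      (d : ℝ) / u / 2 * ((ip x x - ip x' x') + (ip y y - ip y' y')) := by
    rw [← huxy] at hu ⊢
    field_simp
    ring
  rw [Real.log_div hv.ne' hu.ne']
  simp only [psi, ip_sub_left, ip_sub_right, ip_comm x' x, ip_comm y' y, huxy]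
  linear_combination -h3 + e x' - e x + e' y' - e' y

lemma isMax_psi {β u : ℝ} {m s x y : Fin d → ℝ} (hd : 1 ≤ d) (hu : 0 < u)
    (hx : ((d : ℝ) / u - β) • x = β • m) (hy : ((d : ℝ) / u) • y = β • s)
    (huxy : 1 - ip x x - ip y y = u) (hβu : β ≤ d / u) (hor : β < d / u ∨ x = 0)
    {x' y' : Fin d → ℝ} (h' : inBall d x' y') :
    psi d β m s x' y' ≤ psi d β m s x y ∧
      (psi d β m s x y ≤ psi d β m s x' y' → x' = x ∧ y' = y) := by
  have hid := psi_sub_psi hu hx hy huxy h'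
  have hv : 0 < 1 - ip x' x' - ip y' y' := by unfold inBall at h'; linarith
  have hr : 0 < (1 - ip x' x' - ip y' y') / u := div_pos hv hu
  have hd0 : (0 : ℝ) < d := by exact_mod_cast hd
  have h1 : 0 ≤ ((d : ℝ) / u - β) / 2 * ip (x' - x) (x' - x) :=
    mul_nonneg (by linarith) (ip_self_nonneg _)
  have h2 : 0 ≤ (d : ℝ) / u / 2 * ip (y' - y) (y' - y) :=
    mul_nonneg (by positivity) (ip_self_nonneg _)
  have h3 : 0 ≤ (d : ℝ) / 2 * ((1 - ip x' x' - ip y' y') / u - 1 -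
          Real.log ((1 - ip x' x' - ip y' y') / u)) :=
    mul_nonneg (by positivity) (by linarith [Real.log_le_sub_one_of_pos hr])
  refine ⟨by linarith, fun hle => ?_⟩
  have h2' : (d : ℝ) / u / 2 * ip (y' - y) (y' - y) = 0 := by linarith
  have h3' : (d : ℝ) / 2 * ((1 - ip x' x' - ip y' y') / u - 1 -
          Real.log ((1 - ip x' x' - ip y' y') / u)) = 0 := by linarith
  have h1' : ((d : ℝ) / u - β) / 2 * ip (x' - x) (x' - x) = 0 := by linarith
  have hyy : y' = y := by
    rcases mul_eq_zero.1 h2' with h | h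
    · have : 0 < (d : ℝ) / u / 2 := by positivity
      linarith
    · exact sub_eq_zero.1 (ip_self_eq_zero.1 h)
  refine ⟨?_, hyy⟩
  rcases hor with hlt | h0
  · rcases mul_eq_zero.1 h1' with h | h
    · linarith
    · exact sub_eq_zero.1 (ip_self_eq_zero.1 h)
  · have h4 : (1 - ip x' x' - ip y' y') / u = 1 := by
      by_contra hne
      have := Real.log_lt_sub_one_of_pos hr hne
      rcases mul_eq_zero.1 h3' with h | h <;> linarith
    rw [div_eq_one_iff_eq hu.ne', ← huxy, hyy] at h4
    have h5 : ip x' x' = ip x x := by linarith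
    rw [h0, ip_self_eq_zero.2 rfl] at h5
    rw [ip_self_eq_zero.1 h5, h0]

/-- The stationarity equations of the tilting function are solvable in the concave regime. -/
lemma exists_stationary (hd : 1 ≤ d) {β : ℝ} (hβ : 0 < β) (m s : Fin d → ℝ)
    (hcase : m ≠ 0 ∨ (m = 0 ∧ 1 ≤ ip s s) ∨
      (m = 0 ∧ ip s s < 1 ∧ β ≤ (d : ℝ) / (1 - ip s s))) :
    ∃ (x y : Fin d → ℝ) (u : ℝ), 0 < u ∧ ((d : ℝ) / u - β) • x = β • m ∧
      ((d : ℝ) / u) • y = β • s ∧ 1 - ip x x - ip y y = u ∧ β ≤ d / u ∧ (β < d / u ∨ x = 0) := by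
  have hd0 : (0 : ℝ) < d := by exact_mod_cast hd
  have hS := ip_self_nonneg s
  by_cases hm : m = 0
  · have hcont : ContinuousOn (fun u : ℝ => u + ip s s * (β / d) ^ 2 * u ^ 2) (Set.Icc 0 1) := by
      fun_prop
    have hmem : (1 : ℝ) ∈ Set.Icc ((fun u : ℝ => u + ip s s * (β / d) ^ 2 * u ^ 2) 0)
        ((fun u : ℝ => u + ip s s * (β / d) ^ 2 * u ^ 2) 1) := by
      constructor
      · simp
      · have : 0 ≤ ip s s * (β / d) ^ 2 := by positivity
        simp only
        linarith
    obtain ⟨u, ⟨hu0, -⟩, hu⟩ := intermediate_value_Icc zero_le_one hcont hmem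
    simp only at hu
    have hupos : 0 < u := hu0.lt_of_ne (by rintro rfl; simp at hu)
    have hβu : β ≤ d / u := by
      rw [le_div_iff₀ hupos]
      by_contra! hlt
      have h1 : 1 < u * β / d := by rwa [one_lt_div hd0, mul_comm]
      have h2 : 1 < u ^ 2 * (β / d) ^ 2 := by
        have : u ^ 2 * (β / d) ^ 2 = (u * β / d) ^ 2 := by ring
        rw [this]
        exact one_lt_pow₀ h1 two_ne_zero
      rcases hcase with h | ⟨-, h⟩ | ⟨-, h, h'⟩
      · exact h hm
      · nlinarith
      · rw [le_div_iff₀ (by linarith)] at h'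
        have h3 : u + ip s s ≤ 1 := by nlinarith
        nlinarith
    refine ⟨0, (u * β / d) • s, u, hupos, by simp [hm], ?_, ?_, hβu, Or.inr rfl⟩
    · rw [smul_smul]
      congr 1
      field_simp
    · rw [ip_smul_left, ip_smul_right, ip_self_eq_zero.2 rfl]
      linear_combination -hu
  · have hM := ip_self_pos hm
    let P : ℝ → ℝ := fun u => (u + ip s s * (β / d) ^ 2 * u ^ 2 - 1) * (d - β * u) ^ 2 +
      β ^ 2 * u ^ 2 * ip m m
    have hcont : ContinuousOn P (Set.Icc 0 (d / β)) := by fun_prop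
    have hmem : (0 : ℝ) ∈ Set.Ioo (P 0) (P (d / β)) := by
      constructor
      · simp only [P]
        have : 0 < (d : ℝ) ^ 2 := by positivity
        nlinarith
      · simp only [P]
        have : (d : ℝ) - β * (d / β) = 0 := by field_simp; ring
        rw [this]
        have : 0 < β ^ 2 * (d / β) ^ 2 * ip m m := by positivity
        linarith
    obtain ⟨u, ⟨hu0, hu1⟩, hu⟩ := intermediate_value_Ioo (by positivity) hcont hmem
    rw [lt_div_iff₀ hβ] at hu1
    have hβu : β < d / u := by rw [lt_div_iff₀ hu0]; linarith
    have hpos : 0 < d - β * u := by linarith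
    refine ⟨(β * u / (d - β * u)) • m, (u * β / d) • s, u, hu0, ?_, ?_, ?_, hβu.le, Or.inl hβu⟩
    · rw [smul_smul]
      congr 1
      field_simp
    · rw [smul_smul]
      congr 1
      field_simp
    · simp only [ip_smul_left, ip_smul_right]
      have : (d - β * u) ^ 2 ≠ 0 := by positivity
      have h2 : (β * u / (d - β * u)) * ((β * u / (d - β * u)) * ip m m) =
        β ^ 2 * u ^ 2 * ip m m / (d - β * u) ^ 2 := by field_simp
      have h3 : β ^ 2 * u ^ 2 * ip m m = -(u + ip s s * (β / d) ^ 2 * u ^ 2 - 1) * (d - β * u) ^ 2 := by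
        simp only [P] at hu
        linarith
      rw [h2, h3, mul_div_assoc, div_self this]
      ring

end Optimization

section Laplace

variable {V : Type*} [MeasurableSpace V]

/-- The unnormalized measure with exponential weight `n Φ`. -/
noncomputable def expTilt (μ : Measure V) (n : ℕ) (Φ : V → ℝ) : Measure V :=
  μ.withDensity fun a => ENNReal.ofReal (Real.exp (n * Φ a))

lemma expTilt_le (μ : Measure V) {n n₀ : ℕ} (hn : n₀ ≤ n) {Φ Φ' : V → ℝ} {ε M : ℝ}
    (h : ∀ a, |Φ' a - Φ a| ≤ ε) {S : Set V} (hS : MeasurableSet S) (hM : ∀ a ∈ S, Φ a ≤ M) :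
    expTilt μ n Φ' S ≤ ENNReal.ofReal (Real.exp ((n - n₀ : ℝ) * M + n * ε)) *
      ∫⁻ a, ENNReal.ofReal (Real.exp (n₀ * Φ a)) ∂μ := by
  rw [expTilt, withDensity_apply _ hS]
  calc ∫⁻ a in S, ENNReal.ofReal (Real.exp (n * Φ' a)) ∂μ
      ≤ ∫⁻ a in S, ENNReal.ofReal (Real.exp ((n - n₀ : ℝ) * M + n * ε)) *
          ENNReal.ofReal (Real.exp (n₀ * Φ a)) ∂μ := by
        refine setLIntegral_mono' hS fun a ha => ?_
        rw [← ENNReal.ofReal_mul (Real.exp_pos _).le, ← Real.exp_add]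
        refine ENNReal.ofReal_le_ofReal (Real.exp_le_exp.2 ?_)
        have h1 : Φ' a ≤ Φ a + ε := by linarith [(abs_le.1 (h a)).2]
        have h2 : (n : ℝ) * Φ' a ≤ n * (Φ a + ε) := by gcongr
        have h3 : (n₀ : ℝ) ≤ n := by exact_mod_cast hn
        have h4 : (n - n₀ : ℝ) * Φ a ≤ (n - n₀ : ℝ) * M :=
          mul_le_mul_of_nonneg_left (hM a ha) (by linarith)
        linarith
    _ ≤ ∫⁻ a, ENNReal.ofReal (Real.exp ((n - n₀ : ℝ) * M + n * ε)) *
          ENNReal.ofReal (Real.exp (n₀ * Φ a)) ∂μ := setLIntegral_le_lintegral _ _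
    _ = _ := lintegral_const_mul' _ _ ENNReal.ofReal_ne_top

lemma le_expTilt (μ : Measure V) (n : ℕ) {Φ Φ' : V → ℝ} {ε M : ℝ}
    (h : ∀ a, |Φ' a - Φ a| ≤ ε) {S : Set V} (hS : MeasurableSet S) (hM : ∀ a ∈ S, M ≤ Φ a) :
    ENNReal.ofReal (Real.exp (n * (M - ε))) * μ S ≤ expTilt μ n Φ' S := by
  rw [expTilt, withDensity_apply _ hS, ← setLIntegral_const]
  refine setLIntegral_mono' hS fun a ha => ?_
  refine ENNReal.ofReal_le_ofReal (Real.exp_le_exp.2 ?_)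
  have h1 : M - ε ≤ Φ' a := by linarith [(abs_le.1 (h a)).1, hM a ha]
  gcongr

lemma expTilt_univ_ne_top {μ : Measure V} {n n₀ : ℕ} (hn : n₀ ≤ n) {Φ Φ' : V → ℝ} {ε M : ℝ}
    (h : ∀ a, |Φ' a - Φ a| ≤ ε) (hM : ∀ a, Φ a ≤ M)
    (hfin : ∫⁻ a, ENNReal.ofReal (Real.exp (n₀ * Φ a)) ∂μ ≠ ⊤) :
    expTilt μ n Φ' Set.univ ≠ ⊤ :=
  ne_top_of_le_ne_top (ENNReal.mul_ne_top ENNReal.ofReal_ne_top hfin)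
    (expTilt_le μ hn h MeasurableSet.univ fun a _ => hM a)

variable [TopologicalSpace V]

lemma expTilt_univ_ne_zero {μ : Measure V} [μ.IsOpenPosMeasure] [Nonempty V] (n : ℕ) {Φ : V → ℝ}
    (hΦ : Measurable Φ) : expTilt μ n Φ Set.univ ≠ 0 := by
  rw [expTilt, withDensity_apply _ MeasurableSet.univ, Measure.restrict_univ]
  intro h
  rw [lintegral_eq_zero_iff (by fun_prop)] at h
  have h2 : ∀ᵐ a ∂μ, False := by
    filter_upwards [h] with a ha
    rw [Pi.zero_apply, ENNReal.ofReal_eq_zero] at ha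
    linarith [Real.exp_pos (n * Φ a)]
  rw [ae_iff] at h2
  simp only [not_false_eq_true, Set.ofPred_true] at h2
  exact isOpen_univ.measure_ne_zero μ Set.univ_nonempty h2

variable [OpensMeasurableSpace V]

/-- Laplace's method: exponentially tilted measures concentrate at a strict maximum. -/
lemma tendsto_expTilt_compl (μ : Measure V) [μ.IsOpenPosMeasure] {Φ : V → ℝ} (hΦ : Continuous Φ)
    {Φn : ℕ → V → ℝ} {ε : ℕ → ℝ} (hε : Tendsto ε atTop (𝓝 0))
    (h : ∀ n a, |Φn n a - Φ a| ≤ ε n) {n₀ : ℕ}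
    (hfin : ∫⁻ a, ENNReal.ofReal (Real.exp (n₀ * Φ a)) ∂μ ≠ ⊤) {a₀ : V} {U : Set V}
    (hU : MeasurableSet U) {δ : ℝ} (hδ : 0 < δ) (hgap : ∀ a, a ∉ U → Φ a ≤ Φ a₀ - δ) :
    Tendsto (fun n => (expTilt μ n (Φn n) Set.univ)⁻¹ * expTilt μ n (Φn n) Uᶜ) atTop (𝓝 0) := by
  set M := Φ a₀
  set K := ∫⁻ a, ENNReal.ofReal (Real.exp (n₀ * Φ a)) ∂μ
  set W : Set V := {a | M - δ / 4 < Φ a}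
  have hW : IsOpen W := isOpen_lt continuous_const hΦ
  have hW0 : μ W ≠ 0 := hW.measure_ne_zero μ ⟨a₀, by simp only [W, Set.mem_ofPred_eq, M]; linarith⟩
  have hbound : ∀ᶠ n in atTop, (expTilt μ n (Φn n) Set.univ)⁻¹ * expTilt μ n (Φn n) Uᶜ ≤
      ENNReal.ofReal (Real.exp (-(δ / 2) * n + (-(n₀ * (M - δ))))) * ((μ W)⁻¹ * K) := by
    filter_upwards [eventually_ge_atTop n₀, hε.eventually (gt_mem_nhds (by linarith : 0 < δ / 8))]
      with n hn hεn
    have h1 := expTilt_le μ hn (h n) hU.compl (M := M - δ) fun a ha => hgap a ha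
    have h2 := (le_expTilt μ n (h n) hW.measurableSet (M := M - δ / 4) fun a ha => le_of_lt ha).trans
      (measure_mono (Set.subset_univ W))
    have h2' := ENNReal.inv_le_inv.2 h2
    rw [ENNReal.mul_inv (Or.inl (ENNReal.ofReal_pos.2 (Real.exp_pos _)).ne')
      (Or.inl ENNReal.ofReal_ne_top), ← ENNReal.ofReal_inv_of_pos (Real.exp_pos _),
      ← Real.exp_neg] at h2'
    refine (mul_le_mul' h2' h1).trans ?_
    rw [mul_mul_mul_comm, ← ENNReal.ofReal_mul (Real.exp_pos _).le, ← Real.exp_add]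
    refine mul_le_mul_left (ENNReal.ofReal_le_ofReal (Real.exp_le_exp.2 ?_)) _
    have : (n : ℝ) * ε n ≤ n * (δ / 8) := by gcongr
    linarith
  have hlim : Tendsto (fun n : ℕ => ENNReal.ofReal
      (Real.exp (-(δ / 2) * n + (-(n₀ * (M - δ))))) * ((μ W)⁻¹ * K)) atTop (𝓝 0) := by
    have h1 : Tendsto (fun n : ℕ => -(δ / 2) * (n : ℝ) + (-(n₀ * (M - δ)))) atTop atBot :=
      tendsto_atBot_add_const_right _ _
        (tendsto_natCast_atTop_atTop.const_mul_atTop_of_neg (by linarith))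
    have h2 := ENNReal.tendsto_ofReal (Real.tendsto_exp_atBot.comp h1)
    rw [ENNReal.ofReal_zero] at h2
    have h3 := ENNReal.Tendsto.mul_const (b := (μ W)⁻¹ * K) h2
      (Or.inr (ENNReal.mul_ne_top (ENNReal.inv_ne_top.2 hW0) hfin))
    simpa using h3
  exact tendsto_of_tendsto_of_tendsto_of_le_of_le' tendsto_const_nhds hlim
    (Eventually.of_forall fun _ => zero_le) hbound

lemma tendsto_integral_of_concentrating {τ : ℕ → Measure V} {n₀ : ℕ}
    (hτ : ∀ n, n₀ ≤ n → IsProbabilityMeasure (τ n)) {a₀ : V}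
    (hconc : ∀ U : Set V, IsOpen U → a₀ ∈ U → Tendsto (fun n => τ n Uᶜ) atTop (𝓝 0))
    {g : V → ℝ} (hg0 : ∀ a, 0 ≤ g a) {B : ℝ} (hB : ∀ a, g a ≤ B)
    (hc : Continuous g) (hga : g a₀ = 0) :
    Tendsto (fun n => ∫ a, g a ∂(τ n)) atTop (𝓝 0) := by
  rw [Metric.tendsto_atTop']
  intro e he
  set U : Set V := {a | g a < e / 2}
  have hU : IsOpen U := isOpen_lt hc continuous_const
  have h1 := hconc U hU (by simp only [U, Set.mem_ofPred_eq, hga]; linarith)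
  have hB0 : 0 ≤ B := (hg0 a₀).trans (hB a₀)
  have h2 : Tendsto (fun n => B * (τ n).real Uᶜ) atTop (𝓝 0) := by
    have := ((ENNReal.tendsto_toReal ENNReal.zero_ne_top).comp h1).const_mul B
    simpa [Measure.real] using this
  obtain ⟨N, hN⟩ := eventually_atTop.1 (h2.eventually (gt_mem_nhds (by linarith : 0 < e / 2)))
  refine ⟨max N n₀, fun n hn => ?_⟩
  have := hτ n (by omega)
  have h3 := hN n (by omega)
  rw [Real.dist_eq, sub_zero, abs_of_nonneg (integral_nonneg hg0)]
  have h4 : ∫ a, g a ∂(τ n) ≤ ∫ a, (e / 2 + Uᶜ.indicator (fun _ => B) a) ∂(τ n) := by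
    refine integral_mono_of_nonneg (ae_of_all _ hg0) ?_ (ae_of_all _ fun a => ?_)
    · exact (integrable_const _).add ((integrable_const _).indicator hU.measurableSet.compl)
    · by_cases ha : a ∈ U
      · have : a ∉ Uᶜ := by simpa using ha
        simp only [Set.indicator_of_notMem this, add_zero]
        exact le_of_lt ha
      · have : a ∈ Uᶜ := ha
        simp only [Set.indicator_of_mem this]
        linarith [hB a]
  rw [integral_add (integrable_const _) ((integrable_const _).indicator hU.measurableSet.compl),
    integral_indicator_const _ hU.measurableSet.compl] at h4
  simp only [integral_const, smul_eq_mul, probReal_univ, one_mul] at h4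
  linarith

end Laplace

section Tilting

variable {d : ℕ}

/-- The first block of coordinates of the central projection of `a` into the open unit ball. -/
noncomputable def xOf (a : Fin d ⊕ Fin d → ℝ) : Fin d → ℝ :=
  (√(1 + sqLen a))⁻¹ • fun j => a (Sum.inl j)

/-- The second block of coordinates of the central projection of `a` into the open unit ball. -/
noncomputable def yOf (a : Fin d ⊕ Fin d → ℝ) : Fin d → ℝ :=
  (√(1 + sqLen a))⁻¹ • fun j => a (Sum.inr j)

lemma sqrt_one_add_sqLen_pos {κ : Type*} [Fintype κ] (a : κ → ℝ) : 0 < √(1 + sqLen a) :=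
  Real.sqrt_pos.2 (by linarith [sqLen_nonneg a])

@[fun_prop]
lemma continuous_xOf : Continuous (xOf : (Fin d ⊕ Fin d → ℝ) → Fin d → ℝ) := by
  unfold xOf
  have h : ∀ a : Fin d ⊕ Fin d → ℝ, √(1 + sqLen a) ≠ 0 := fun a => (sqrt_one_add_sqLen_pos a).ne'
  fun_prop (disch := assumption)

@[fun_prop]
lemma continuous_yOf : Continuous (yOf : (Fin d ⊕ Fin d → ℝ) → Fin d → ℝ) := by
  unfold yOf
  have h : ∀ a : Fin d ⊕ Fin d → ℝ, √(1 + sqLen a) ≠ 0 := fun a => (sqrt_one_add_sqLen_pos a).ne'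
  fun_prop (disch := assumption)

lemma one_sub_ip_xOf_yOf (a : Fin d ⊕ Fin d → ℝ) :
    1 - ip (xOf a) (xOf a) - ip (yOf a) (yOf a) = (1 + sqLen a)⁻¹ := by
  have h0 := sqLen_nonneg a
  have h : (√(1 + sqLen a)) ^ 2 = 1 + sqLen a := Real.sq_sqrt (by linarith)
  have h1 : sqLen a = ip (fun j => a (Sum.inl j)) (fun j => a (Sum.inl j)) +
      ip (fun j => a (Sum.inr j)) (fun j => a (Sum.inr j)) := by
    simp [sqLen, ip, sq]
  simp only [xOf, yOf, ip_smul_left, ip_smul_right]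
  have h2 : (√(1 + sqLen a))⁻¹ * (√(1 + sqLen a))⁻¹ = (1 + sqLen a)⁻¹ := by
    rw [← mul_inv, ← sq, h]
  have h3 : (1 + sqLen a)⁻¹ * (1 + sqLen a) = 1 := inv_mul_cancel₀ (by linarith)
  linear_combination (-(ip (fun j => a (Sum.inl j)) (fun j => a (Sum.inl j)) +
      ip (fun j => a (Sum.inr j)) (fun j => a (Sum.inr j)))) * h2 - h3 + (1 + sqLen a)⁻¹ * h1

lemma inBall_xOf_yOf (a : Fin d ⊕ Fin d → ℝ) : inBall d (xOf a) (yOf a) := by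
  have h := one_sub_ip_xOf_yOf a
  have h1 : 0 < (1 + sqLen a)⁻¹ := inv_pos.2 (by linarith [sqLen_nonneg a])
  unfold inBall
  linarith

lemma abs_le_one_of_ip {x : Fin d → ℝ} (h : ip x x ≤ 1) (j : Fin d) : |x j| ≤ 1 := by
  have : x j * x j ≤ ip x x :=
    Finset.single_le_sum (f := fun j => x j * x j) (fun _ _ => mul_self_nonneg _) (Finset.mem_univ j)
  rw [abs_le_one_iff_mul_self_le_one]
  linarith

lemma abs_xOf_le (a : Fin d ⊕ Fin d → ℝ) (j : Fin d) : |xOf a j| ≤ 1 :=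
  abs_le_one_of_ip (by have := inBall_xOf_yOf a; unfold inBall at this
                       linarith [ip_self_nonneg (yOf a)]) j

lemma abs_yOf_le (a : Fin d ⊕ Fin d → ℝ) (j : Fin d) : |yOf a j| ≤ 1 :=
  abs_le_one_of_ip (by have := inBall_xOf_yOf a; unfold inBall at this
                       linarith [ip_self_nonneg (xOf a)]) j

lemma abs_ip_le {x : Fin d → ℝ} (hx : ∀ j, |x j| ≤ 1) (c : Fin d → ℝ) : |ip c x| ≤ ∑ j, |c j| := by
  refine (Finset.abs_sum_le_sum_abs _ _).trans (Finset.sum_le_sum fun j _ => ?_)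
  rw [abs_mul]
  exact mul_le_of_le_one_right (abs_nonneg _) (hx j)

/-- The tilting function in central-projection coordinates. -/
noncomputable def tiltFn (β : ℝ) (m s : Fin d → ℝ) (a : Fin d ⊕ Fin d → ℝ) : ℝ :=
  psi d β m s (xOf a) (yOf a)

lemma tiltFn_eq (β : ℝ) (m s : Fin d → ℝ) (a : Fin d ⊕ Fin d → ℝ) :
    tiltFn β m s a = β / 2 * ip (xOf a) (xOf a) + β * ip m (xOf a) + β * ip s (yOf a) -
      (d : ℝ) / 2 * Real.log (1 + sqLen a) := by
  rw [tiltFn, psi, one_sub_ip_xOf_yOf, Real.log_inv]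
  ring

lemma continuous_ip {X : Type*} [TopologicalSpace X] {f g : X → Fin d → ℝ} (hf : Continuous f)
    (hg : Continuous g) : Continuous fun x => ip (f x) (g x) := by
  unfold ip; fun_prop

lemma continuous_tiltFn (β : ℝ) (m s : Fin d → ℝ) : Continuous (tiltFn β m s) := by
  have h : tiltFn β m s = _ := funext (tiltFn_eq β m s)
  rw [h]
  have h1 : ∀ a : Fin d ⊕ Fin d → ℝ, 1 + sqLen a ≠ 0 := fun a => by
    have := sqLen_nonneg a
    positivity
  have h2 := continuous_ip (continuous_xOf (d := d)) continuous_xOf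
  have h3 := continuous_ip (continuous_const (y := m)) (continuous_xOf (d := d))
  have h4 := continuous_ip (continuous_const (y := s)) (continuous_yOf (d := d))
  have h5 : Continuous fun a : Fin d ⊕ Fin d → ℝ => Real.log (1 + sqLen a) :=
    Continuous.log (by fun_prop) h1
  fun_prop

lemma abs_tiltFn_sub_le {β : ℝ} (hβ : 0 < β) (m s m' s' : Fin d → ℝ) (a : Fin d ⊕ Fin d → ℝ) :
    |tiltFn β m' s' a - tiltFn β m s a| ≤ β * (∑ j, |m' j - m j| + ∑ j, |s' j - s j|) := by
  have h : tiltFn β m' s' a - tiltFn β m s a =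
      β * (ip (m' - m) (xOf a) + ip (s' - s) (yOf a)) := by
    simp only [tiltFn, psi, ip_sub_left]
    ring
  rw [h, abs_mul, abs_of_pos hβ]
  gcongr
  exact (abs_add_le _ _).trans
    (add_le_add (abs_ip_le (abs_xOf_le a) _) (abs_ip_le (abs_yOf_le a) _))

lemma tiltFn_le {β : ℝ} (hβ : 0 < β) (m s : Fin d → ℝ) (a : Fin d ⊕ Fin d → ℝ) :
    tiltFn β m s a ≤ β * (1 + ∑ j, |m j| + ∑ j, |s j|) - (d : ℝ) / 2 * Real.log (1 + sqLen a) := by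
  rw [tiltFn_eq]
  have h1 : ip (xOf a) (xOf a) ≤ 1 := by
    have := inBall_xOf_yOf a
    unfold inBall at this
    linarith [ip_self_nonneg (yOf a)]
  have h2 := (abs_le.1 (abs_ip_le (abs_xOf_le a) m)).2
  have h3 := (abs_le.1 (abs_ip_le (abs_yOf_le a) s)).2
  have h4 : β * ip m (xOf a) ≤ β * ∑ j, |m j| := by gcongr
  have h5 : β * ip s (yOf a) ≤ β * ∑ j, |s j| := by gcongr
  have h6 : β / 2 * ip (xOf a) (xOf a) ≤ β / 2 * 1 := by gcongr
  linarith

lemma lintegral_exp_tiltFn_ne_top (hd : 1 ≤ d) {β : ℝ} (hβ : 0 < β) (m s : Fin d → ℝ) :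
    ∫⁻ a, ENNReal.ofReal (Real.exp ((3 : ℕ) * tiltFn β m s a)) ≠ ⊤ := by
  have hi : Integrable fun a : Fin d ⊕ Fin d → ℝ => (√(1 + sqLen a) ^ (3 * d))⁻¹ :=
    integrable_inv_sqrt_pow (by simp; omega)
  have hi2 := (hi.const_mul (Real.exp (3 * (β * (1 + ∑ j, |m j| + ∑ j, |s j|))))).lintegral_lt_top
  refine ne_top_of_le_ne_top hi2.ne (lintegral_mono fun a => ENNReal.ofReal_le_ofReal ?_)
  have h0 : 0 < 1 + sqLen a := by linarith [sqLen_nonneg a]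
  have h1 : (√(1 + sqLen a) ^ (3 * d))⁻¹ =
      Real.exp (-(3 * ((d : ℝ) / 2 * Real.log (1 + sqLen a)))) := by
    rw [Real.exp_neg, Real.sqrt_eq_rpow, ← Real.rpow_natCast, ← Real.rpow_mul h0.le,
      Real.rpow_def_of_pos h0]
    congr 2
    push_cast
    ring
  rw [h1, ← Real.exp_add]
  refine Real.exp_le_exp.2 ?_
  have := tiltFn_le hβ m s a
  push_cast
  linarith

lemma exists_gap (hd : 1 ≤ d) {β : ℝ} (hβ : 0 < β) {m s : Fin d → ℝ} {a₀ : Fin d ⊕ Fin d → ℝ}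
    (hmax : ∀ a, a ≠ a₀ → tiltFn β m s a < tiltFn β m s a₀) {U : Set (Fin d ⊕ Fin d → ℝ)}
    (hU : IsOpen U) (ha₀ : a₀ ∈ U) :
    ∃ δ > 0, ∀ a, a ∉ U → tiltFn β m s a ≤ tiltFn β m s a₀ - δ := by
  set M := tiltFn β m s a₀
  have hcont := continuous_tiltFn β m s
  set K : Set (Fin d ⊕ Fin d → ℝ) := Uᶜ ∩ {a | M - 1 ≤ tiltFn β m s a}
  have hK : IsCompact K := by
    refine Metric.isCompact_of_isClosed_isBounded
      (hU.isClosed_compl.inter (isClosed_le continuous_const hcont)) ?_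
    set C := β * (1 + ∑ j, |m j| + ∑ j, |s j|)
    refine (Metric.isBounded_closedBall (x := 0)
      (r := √(Real.exp (2 / d * (C - M + 1))))).subset ?_
    intro a ha
    have h1 := tiltFn_le hβ m s a
    have h2 : M - 1 ≤ tiltFn β m s a := ha.2
    have hd0 : (0 : ℝ) < d := by exact_mod_cast hd
    have h0 : 0 < 1 + sqLen a := by linarith [sqLen_nonneg a]
    have h3 : Real.log (1 + sqLen a) ≤ 2 / d * (C - M + 1) := by
      have h3 : (d : ℝ) / 2 * Real.log (1 + sqLen a) ≤ C - M + 1 := by linarith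
      have h4 : 2 / d * ((d : ℝ) / 2 * Real.log (1 + sqLen a)) ≤ 2 / d * (C - M + 1) := by
        gcongr
      have h5 : 2 / d * ((d : ℝ) / 2 * Real.log (1 + sqLen a)) = Real.log (1 + sqLen a) := by
        field_simp
      linarith
    have h4 := (Real.log_le_iff_le_exp h0).1 h3
    rw [mem_closedBall_zero_iff]
    refine Real.le_sqrt_of_sq_le ?_
    linarith [norm_sq_le_sqLen a]
  rcases K.eq_empty_or_nonempty with hKe | hKn
  · refine ⟨1, one_pos, fun a ha => ?_⟩
    by_contra! h
    have : a ∈ K := ⟨ha, h.le⟩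
    simp [hKe] at this
  · obtain ⟨a₁, ha₁, hmax₁⟩ := hK.exists_isMaxOn hKn hcont.continuousOn
    have hlt : tiltFn β m s a₁ < M := hmax a₁ (by rintro rfl; exact ha₁.1 ha₀)
    refine ⟨min 1 (M - tiltFn β m s a₁), lt_min one_pos (by linarith), fun a ha => ?_⟩
    by_cases haK : a ∈ K
    · have : tiltFn β m s a ≤ tiltFn β m s a₁ := hmax₁ haK
      linarith [min_le_right 1 (M - tiltFn β m s a₁)]
    · have : tiltFn β m s a < M - 1 := by
        by_contra! h
        exact haK ⟨ha, h⟩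
      linarith [min_le_left 1 (M - tiltFn β m s a₁)]

/-- The parameter of a point of the open unit ball. -/
noncomputable def ballParam (x y : Fin d → ℝ) : Fin d ⊕ Fin d → ℝ :=
  (√(1 - ip x x - ip y y))⁻¹ • Sum.elim x y

lemma sqLen_ballParam {x y : Fin d → ℝ} (h : inBall d x y) :
    1 + sqLen (ballParam x y) = (1 - ip x x - ip y y)⁻¹ := by
  have hu : 0 < 1 - ip x x - ip y y := by unfold inBall at h; linarith
  have h1 : sqLen (Sum.elim x y) = ip x x + ip y y := by simp [sqLen, ip, sq]
  rw [ballParam, sqLen_smul, inv_pow, Real.sq_sqrt hu.le, h1]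
  field_simp
  ring

lemma xOf_ballParam {x y : Fin d → ℝ} (h : inBall d x y) :
    xOf (ballParam x y) = x ∧ yOf (ballParam x y) = y := by
  have hu : 0 < 1 - ip x x - ip y y := by unfold inBall at h; linarith
  have hs : √(1 - ip x x - ip y y) ≠ 0 := (Real.sqrt_pos.2 hu).ne'
  constructor <;> ext j
  · rw [xOf, sqLen_ballParam h, Real.sqrt_inv, inv_inv]
    simp [ballParam, hs]
  · rw [yOf, sqLen_ballParam h, Real.sqrt_inv, inv_inv]
    simp [ballParam, hs]

lemma ballParam_xOf_yOf (a : Fin d ⊕ Fin d → ℝ) : ballParam (xOf a) (yOf a) = a := by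
  rw [ballParam, one_sub_ip_xOf_yOf, Real.sqrt_inv, inv_inv]
  have h := (sqrt_one_add_sqLen_pos a).ne'
  ext (j | j) <;> simp [xOf, yOf, h]

lemma tiltFn_lt_of_unique {β : ℝ} {m s x y : Fin d → ℝ} (hxy : inBall d x y)
    (hmax : ∀ x' y', inBall d x' y' → psi d β m s x' y' ≤ psi d β m s x y ∧
      (psi d β m s x y ≤ psi d β m s x' y' → x' = x ∧ y' = y)) (a : Fin d ⊕ Fin d → ℝ)
    (ha : a ≠ ballParam x y) : tiltFn β m s a < tiltFn β m s (ballParam x y) := by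
  obtain ⟨h1, h2⟩ := xOf_ballParam hxy
  have h3 : tiltFn β m s (ballParam x y) = psi d β m s x y := by rw [tiltFn, h1, h2]
  rw [h3]
  by_contra! hle
  obtain ⟨e1, e2⟩ := (hmax _ _ (inBall_xOf_yOf a)).2 hle
  exact ha (by rw [← ballParam_xOf_yOf a, e1, e2])

end Tilting

section FieldBasis

variable {n d : ℕ}

/-- The vector supported on the `j`-th components, with entries `c`. -/
noncomputable def colVec (j : Fin d) (c : Fin n → ℝ) : EuclideanSpace ℝ (Fin n × Fin d) :=
  WithLp.toLp 2 fun p => if p.2 = j then c p.1 else 0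

lemma inner_colVec (j : Fin d) (c : Fin n → ℝ) (v : EuclideanSpace ℝ (Fin n × Fin d)) :
    inner ℝ (colVec j c) v = ∑ i, c i * v (i, j) := by
  simp [colVec, PiLp.inner_apply, Fintype.sum_prod_type, mul_comm]

/-- The normalized constant vectors and the normalized fluctuation vectors of the field. -/
noncomputable def fieldVec (d n : ℕ) (h : ℕ → Fin d → ℝ) :
    Fin d ⊕ Fin d → EuclideanSpace ℝ (Fin n × Fin d) :=
  Sum.elim (fun j => colVec j fun _ => (√n)⁻¹)
    fun j => colVec j fun i => (h i j - sampleMean d h n j) / sampleStd d h n j * (√n)⁻¹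

lemma sum_sub_sampleMean (hn : n ≠ 0) (h : ℕ → Fin d → ℝ) (j : Fin d) :
    ∑ i : Fin n, (h i j - sampleMean d h n j) = 0 := by
  have hn0 : (n : ℝ) ≠ 0 := by exact_mod_cast hn
  rw [Finset.sum_sub_distrib, Fin.sum_univ_eq_sum_range (fun i => h i j) n]
  simp only [sampleMean, Finset.sum_const, Finset.card_univ, Fintype.card_fin, nsmul_eq_mul]
  field_simp
  ring

lemma sum_sub_sampleMean_sq (hn : n ≠ 0) (h : ℕ → Fin d → ℝ) (j : Fin d)
    (hs : 0 < sampleStd d h n j) :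
    ∑ i : Fin n, (h i j - sampleMean d h n j) ^ 2 = n * sampleStd d h n j ^ 2 := by
  have hn0 : (n : ℝ) ≠ 0 := by exact_mod_cast hn
  have h1 : sampleStd d h n j ^ 2 =
      (∑ i ∈ Finset.range n, (h i j) ^ 2) / n - (sampleMean d h n j) ^ 2 :=
    Real.sq_sqrt (Real.sqrt_pos.1 hs).le
  have h2 := sum_sub_sampleMean hn h j
  have h3 : ∑ i : Fin n, (h i j - sampleMean d h n j) ^ 2 =
      ∑ i : Fin n, (h i j) ^ 2 - n * sampleMean d h n j ^ 2
        - 2 * sampleMean d h n j * ∑ i : Fin n, (h i j - sampleMean d h n j) := by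
    rw [Finset.mul_sum]
    have : (n : ℝ) * sampleMean d h n j ^ 2 = ∑ _i : Fin n, sampleMean d h n j ^ 2 := by simp
    rw [this, ← Finset.sum_sub_distrib, ← Finset.sum_sub_distrib]
    refine Finset.sum_congr rfl fun i _ => ?_
    ring
  rw [h3, h2, h1, Fin.sum_univ_eq_sum_range (fun i => (h i j) ^ 2) n]
  field_simp
  ring

lemma orthonormal_fieldVec (hn : n ≠ 0) (h : ℕ → Fin d → ℝ)
    (hs : ∀ j, 0 < sampleStd d h n j) : Orthonormal ℝ (fieldVec d n h) := by
  have hn0 : (0 : ℝ) < n := by exact_mod_cast Nat.pos_of_ne_zero hn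
  have hsq : (√(n : ℝ))⁻¹ * (√(n : ℝ))⁻¹ = (n : ℝ)⁻¹ := by
    rw [← mul_inv, Real.mul_self_sqrt hn0.le]
  rw [orthonormal_iff_ite]
  have hll (j : Fin d) : ∑ _i : Fin n, (√(n : ℝ))⁻¹ * (√(n : ℝ))⁻¹ = 1 := by
    simp [hsq, hn0.ne']
  have hlr (j : Fin d) : ∑ i : Fin n, (√(n : ℝ))⁻¹ *
      ((h i j - sampleMean d h n j) / sampleStd d h n j * (√n)⁻¹) = 0 := by
    have : ∀ i : Fin n, (√(n : ℝ))⁻¹ *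
      ((h i j - sampleMean d h n j) / sampleStd d h n j * (√n)⁻¹) =
      ((√(n : ℝ))⁻¹ * (√(n : ℝ))⁻¹ / sampleStd d h n j) * (h i j - sampleMean d h n j) :=
      fun i => by ring
    simp_rw [this, ← Finset.mul_sum, sum_sub_sampleMean hn, mul_zero]
  have hrr (j : Fin d) : ∑ i : Fin n, ((h i j - sampleMean d h n j) / sampleStd d h n j * (√n)⁻¹) *
      ((h i j - sampleMean d h n j) / sampleStd d h n j * (√n)⁻¹) = 1 := by
    have : ∀ i : Fin n, ((h i j - sampleMean d h n j) / sampleStd d h n j * (√n)⁻¹) *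
      ((h i j - sampleMean d h n j) / sampleStd d h n j * (√n)⁻¹) =
      ((√(n : ℝ))⁻¹ * (√(n : ℝ))⁻¹ / sampleStd d h n j ^ 2) * (h i j - sampleMean d h n j) ^ 2 :=
      fun i => by ring
    simp_rw [this, ← Finset.mul_sum, sum_sub_sampleMean_sq hn h j (hs j), hsq]
    have := (hs j).ne'
    field_simp
  rintro (j | j) (j' | j')
  · simp only [fieldVec, Sum.elim_inl, inner_colVec, Sum.inl.injEq]
    split_ifs with hj
    · subst hj
      simpa [colVec] using hll j
    · simp [colVec, hj]
  · simp only [fieldVec, Sum.elim_inl, Sum.elim_inr, inner_colVec, reduceCtorEq, if_false]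
    by_cases hj : j = j'
    · subst hj
      simpa [colVec] using hlr j
    · simp [colVec, hj]
  · simp only [fieldVec, Sum.elim_inl, Sum.elim_inr, inner_colVec, reduceCtorEq, if_false]
    by_cases hj : j = j'
    · subst hj
      simpa [colVec, mul_comm] using hlr j
    · simp [colVec, hj]
  · simp only [fieldVec, Sum.elim_inr, inner_colVec, Sum.inr.injEq]
    split_ifs with hj
    · subst hj
      simpa [colVec] using hrr j
    · simp [colVec, hj]

lemma exists_fieldBasis (hn : 3 ≤ n) (h : ℕ → Fin d → ℝ) (hs : ∀ j, 0 < sampleStd d h n j) :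
    ∃ b : OrthonormalBasis ((Fin d ⊕ Fin d) ⊕ Fin ((n - 2) * d)) ℝ
      (EuclideanSpace ℝ (Fin n × Fin d)), ∀ k, b (Sum.inl k) = fieldVec d n h k := by
  have hcard : Module.finrank ℝ (EuclideanSpace ℝ (Fin n × Fin d)) =
      Fintype.card ((Fin d ⊕ Fin d) ⊕ Fin ((n - 2) * d)) := by
    obtain ⟨q, rfl⟩ := Nat.exists_eq_add_of_le hn
    simp only [finrank_euclideanSpace, Fintype.card_prod, Fintype.card_fin, Fintype.card_sum]
    have : 3 + q - 2 = q + 1 := by omega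
    rw [this]
    ring
  have ho := orthonormal_fieldVec (by omega) h hs
  have hr : Orthonormal ℝ ((Set.range Sum.inl).domRestrict
      (Sum.elim (fieldVec d n h) (0 : Fin ((n - 2) * d) → EuclideanSpace ℝ (Fin n × Fin d)))) := by
    let e : Set.range (Sum.inl : Fin d ⊕ Fin d → (Fin d ⊕ Fin d) ⊕ Fin ((n - 2) * d)) ≃
      Fin d ⊕ Fin d := (Equiv.ofInjective _ Sum.inl_injective).symm
    have := ho.comp e e.injective
    convert this using 1
    ext1 z
    obtain ⟨k, hk⟩ := z.2
    have hz : z = Equiv.ofInjective _ Sum.inl_injective k := Subtype.ext hk.symm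
    have hek : e z = k := by rw [hz]; exact Equiv.symm_apply_apply _ _
    rw [Set.domRestrict_apply, Function.comp_apply, hek, ← hk, Sum.elim_inl]
  obtain ⟨b, hb⟩ := hr.exists_orthonormalBasis_extension_of_card_eq hcard
  exact ⟨b, fun k => by simpa using hb _ ⟨k, rfl⟩⟩

/-- The Hamiltonian only depends on the coordinates along the field vectors. -/
lemma neg_mul_Hn (hn : n ≠ 0) (β : ℝ) (h : ℕ → Fin d → ℝ) (hs : ∀ j, 0 < sampleStd d h n j)
    (v : EuclideanSpace ℝ (Fin n × Fin d)) {x y : Fin d → ℝ}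
    (hx : ∀ j, inner ℝ (fieldVec d n h (Sum.inl j)) v = x j)
    (hy : ∀ j, inner ℝ (fieldVec d n h (Sum.inr j)) v = y j) :
    -β * Hn d n h (fun i j => √n * v (i, j)) =
      n * (β / 2 * ip x x + β * ip (sampleMean d h n) x + β * ip (sampleStd d h n) y) := by
  have hn0 : (0 : ℝ) < n := by exact_mod_cast Nat.pos_of_ne_zero hn
  have hr : √(n : ℝ) ≠ 0 := (Real.sqrt_pos.2 hn0).ne'
  have hrr : √(n : ℝ) * √n = n := Real.mul_self_sqrt hn0.le
  have hx' (j : Fin d) : ∑ i : Fin n, v (i, j) = √n * x j := by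
    rw [← hx, fieldVec, Sum.elim_inl, inner_colVec, ← Finset.mul_sum, ← mul_assoc,
      mul_inv_cancel₀ hr, one_mul]
  have hy' (j : Fin d) : ∑ i : Fin n, h i j * v (i, j) =
      √n * (sampleMean d h n j * x j + sampleStd d h n j * y j) := by
    have h1 : ∑ i : Fin n, h i j * v (i, j) = ∑ i : Fin n,
        (√n * sampleStd d h n j * ((h i j - sampleMean d h n j) / sampleStd d h n j * (√n)⁻¹ *
          v (i, j)) + sampleMean d h n j * v (i, j)) := by
      refine Finset.sum_congr rfl fun i _ => ?_
      have := (hs j).ne'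
      field_simp
      ring
    rw [h1, Finset.sum_add_distrib, ← Finset.mul_sum, ← Finset.mul_sum, hx', ← hy, fieldVec,
      Sum.elim_inr, inner_colVec]
    ring
  have h1 : ∑ i : Fin n, ∑ i' : Fin n, ip (fun j => √n * v (i, j)) (fun j => √n * v (i', j)) =
      n * (n * ip x x) := by
    calc ∑ i : Fin n, ∑ i' : Fin n, ip (fun j => √n * v (i, j)) (fun j => √n * v (i', j))
        = ∑ i : Fin n, ∑ j, ∑ i' : Fin n, n * (v (i, j) * v (i', j)) := by
          refine Finset.sum_congr rfl fun i _ => ?_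
          simp only [ip]
          rw [Finset.sum_comm]
          refine Finset.sum_congr rfl fun j _ => Finset.sum_congr rfl fun i' _ => ?_
          linear_combination v (i, j) * v (i', j) * hrr
      _ = ∑ j, n * ((∑ i : Fin n, v (i, j)) * ∑ i' : Fin n, v (i', j)) := by
          rw [Finset.sum_comm]
          refine Finset.sum_congr rfl fun j _ => ?_
          rw [Finset.sum_mul_sum, Finset.mul_sum]
          refine Finset.sum_congr rfl fun i _ => ?_
          rw [Finset.mul_sum]
      _ = n * (n * ip x x) := by
          rw [ip, Finset.mul_sum, Finset.mul_sum]
          refine Finset.sum_congr rfl fun j _ => ?_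
          rw [hx']
          linear_combination n * x j * x j * hrr
  have h2 : ∑ i : Fin n, ip (h i) (fun j => √n * v (i, j)) =
      n * (ip (sampleMean d h n) x + ip (sampleStd d h n) y) := by
    simp only [ip]
    rw [Finset.sum_comm, ← Finset.sum_add_distrib, Finset.mul_sum]
    refine Finset.sum_congr rfl fun j _ => ?_
    calc ∑ i : Fin n, h i j * (√n * v (i, j)) = √n * ∑ i : Fin n, h i j * v (i, j) := by
          rw [Finset.mul_sum]
          exact Finset.sum_congr rfl fun i _ => by ring
      _ = _ := by
          rw [hy']
          linear_combination (sampleMean d h n j * x j + sampleStd d h n j * y j) * hrr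
  rw [Hn, h1, h2]
  field_simp
  ring

end FieldBasis

section GibbsRepresentation

lemma withDensity_map_eq {X Y : Type*} [MeasurableSpace X] [MeasurableSpace Y] (μ : Measure X)
    {f : X → Y} (hf : Measurable f) {g : Y → ENNReal} (hg : Measurable g) :
    (μ.map f).withDensity g = (μ.withDensity fun x => g (f x)).map f := by
  ext S hS
  rw [withDensity_apply _ hS, setLIntegral_map hS hg hf, Measure.map_apply hf hS,
    withDensity_apply _ (hf hS)]

variable {κ l E : Type*} [Fintype κ] [Fintype l] [NormedAddCommGroup E] [InnerProductSpace ℝ E]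

lemma inner_inl_coneVec (b : OrthonormalBasis (κ ⊕ l) ℝ E) (p : (κ → ℝ) × (l → ℝ)) (k : κ) :
    inner ℝ (b (Sum.inl k)) (coneVec b p) = (√(1 + sqLen p.1))⁻¹ * p.1 k := by
  rw [coneVec, inner_smul_right, sumVec_eq, ← b.repr_apply_apply, LinearIsometryEquiv.apply_symm_apply]
  simp

variable {d n : ℕ}

lemma expTilt_tiltFn (β : ℝ) (m s : Fin d → ℝ) :
    expTilt volume n (tiltFn β m s) = (coneDensity (Fin d ⊕ Fin d) (n * d)).withDensity
      fun a => ENNReal.ofReal (Real.exp (n * (β / 2 * ip (xOf a) (xOf a) + β * ip m (xOf a) +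
        β * ip s (yOf a)))) := by
  have h2 := continuous_ip (continuous_xOf (d := d)) continuous_xOf
  have h3 := continuous_ip (continuous_const (y := m)) (continuous_xOf (d := d))
  have h4 := continuous_ip (continuous_const (y := s)) (continuous_yOf (d := d))
  have hm : Measurable fun a : Fin d ⊕ Fin d → ℝ => ENNReal.ofReal (Real.exp (n *
      (β / 2 * ip (xOf a) (xOf a) + β * ip m (xOf a) + β * ip s (yOf a)))) :=
    (by fun_prop : Continuous fun a : Fin d ⊕ Fin d → ℝ => Real.exp (n *
      (β / 2 * ip (xOf a) (xOf a) + β * ip m (xOf a) + β * ip s (yOf a)))).measurable.ennreal_ofReal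
  rw [coneDensity, ← withDensity_mul _ (by fun_prop) hm, expTilt]
  congr 1
  ext1 a
  have h0 : 0 < 1 + sqLen a := by linarith [sqLen_nonneg a]
  have h1 : (√(1 + sqLen a) ^ (n * d))⁻¹ =
      Real.exp (-(n * ((d : ℝ) / 2 * Real.log (1 + sqLen a)))) := by
    rw [Real.exp_neg, Real.sqrt_eq_rpow, ← Real.rpow_natCast, ← Real.rpow_mul h0.le,
      Real.rpow_def_of_pos h0]
    congr 2
    push_cast
    ring
  rw [Pi.mul_apply, ← ENNReal.ofReal_mul (by positivity), h1, ← Real.exp_add, tiltFn_eq]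
  congr 2
  ring

/-- Extension by zero of a rescaled finite configuration. -/
noncomputable def extendCfg (d n : ℕ) (v : EuclideanSpace ℝ (Fin n × Fin d)) : ℕ → Fin d → ℝ :=
  fun i j => if hi : i < n then √n * v (⟨i, hi⟩, j) else 0

@[fun_prop]
lemma measurable_extendCfg : Measurable (extendCfg d n) := by
  unfold extendCfg
  refine measurable_pi_lambda _ fun i => measurable_pi_lambda _ fun j => ?_
  by_cases hi : i < n
  · simp only [hi, dif_pos]
    fun_prop
  · simp [hi]

/-- The law of the central-projection parameter under the Gibbs state. -/
noncomputable def paramLaw (d n : ℕ) (β : ℝ) (h : ℕ → Fin d → ℝ) : Measure (Fin d ⊕ Fin d → ℝ) :=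
  (expTilt volume n (tiltFn β (sampleMean d h n) (sampleStd d h n)) Set.univ)⁻¹ •
    expTilt volume n (tiltFn β (sampleMean d h n) (sampleStd d h n))

lemma gibbs_eq (hd : 1 ≤ d) (hn : 3 ≤ n) (β : ℝ) (h : ℕ → Fin d → ℝ)
    (hs : ∀ j, 0 < sampleStd d h n j)
    (hfin : expTilt volume n (tiltFn β (sampleMean d h n) (sampleStd d h n)) Set.univ ≠ ⊤)
    (b : OrthonormalBasis ((Fin d ⊕ Fin d) ⊕ Fin ((n - 2) * d)) ℝ
      (EuclideanSpace ℝ (Fin n × Fin d))) (hb : ∀ k, b (Sum.inl k) = fieldVec d n h k) :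
    gibbs d n β h = ((paramLaw d n β h).prod
      (Measure.pi fun _ : Fin ((n - 2) * d) => ProbabilityTheory.gaussianReal 0 1)).map
      fun p => extendCfg d n (coneVec b p) := by
  have : Nonempty (Fin n × Fin d) := ⟨⟨⟨0, by omega⟩, ⟨0, by omega⟩⟩⟩
  have : Nonempty (Fin ((n - 2) * d)) := ⟨⟨0, Nat.mul_pos (by omega) (by omega)⟩⟩
  set γ := Measure.pi fun _ : Fin ((n - 2) * d) => ProbabilityTheory.gaussianReal 0 1
  set R := expTilt volume n (tiltFn β (sampleMean d h n) (sampleStd d h n)) with hR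
  have : IsFiniteMeasure R := ⟨hfin.lt_top⟩
  let wt : EuclideanSpace ℝ (Fin n × Fin d) → ENNReal := fun v =>
    ENNReal.ofReal (Real.exp (-β * Hn d n h fun i j => √n * v (i, j)))
  have hwt : Measurable wt := by
    have : Continuous fun v : EuclideanSpace ℝ (Fin n × Fin d) =>
        Real.exp (-β * Hn d n h fun i j => √n * v (i, j)) := by
      simp only [Hn, ip]
      fun_prop
    exact this.measurable.ennreal_ofReal
  have hval : Measurable (Subtype.val : Metric.sphere (0 : EuclideanSpace ℝ (Fin n × Fin d)) 1 → _) :=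
    measurable_subtype_coe
  have hc := measurable_coneVec b
  obtain ⟨c, hc0, hct, hμ⟩ := map_val_hausdorffMeasure_sphere b
  have hcard : Fintype.card (Fin d ⊕ Fin d) + Fintype.card (Fin ((n - 2) * d)) = n * d := by
    obtain ⟨q, rfl⟩ := Nat.exists_eq_add_of_le hn
    simp only [Fintype.card_fin, Fintype.card_sum]
    have : 3 + q - 2 = q + 1 := by omega
    rw [this]
    ring
  set ρ : Measure (Metric.sphere (0 : EuclideanSpace ℝ (Fin n × Fin d)) 1) :=
    (μH[((n * d : ℕ) : ℝ) - 1]).withDensity fun Ωp => wt Ωp.val with hρ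
  have hfinC : IsFiniteMeasure (coneDensity (Fin d ⊕ Fin d) (n * d)) :=
    isFiniteMeasure_coneDensity (by
      rw [← hcard]
      have := Fintype.card_pos (α := Fin ((n - 2) * d))
      omega)
  have hwc : (fun p => wt (coneVec b p)) = fun p => ENNReal.ofReal (Real.exp (n *
      (β / 2 * ip (xOf p.1) (xOf p.1) + β * ip (sampleMean d h n) (xOf p.1) +
        β * ip (sampleStd d h n) (yOf p.1)))) := by
    ext1 p
    simp only [wt]
    rw [neg_mul_Hn (by omega) β h hs (coneVec b p) (x := xOf p.1) (y := yOf p.1)]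
    · intro j
      rw [← hb, inner_inl_coneVec]
      rfl
    · intro j
      rw [← hb, inner_inl_coneVec]
      rfl
  have hmap : ρ.map Subtype.val = c • (R.prod γ).map (coneVec b) := by
    rw [hρ, ← withDensity_map_eq _ hval hwt]
    have h1 : Fintype.card (Fin n × Fin d) = n * d := by simp
    rw [h1] at hμ
    rw [hμ, withDensity_smul_measure, coneMeasure, hcard, withDensity_map_eq _ hc hwt, hwc, hR,
      expTilt_tiltFn, prod_withDensity_left]
    have h2 := continuous_ip (continuous_xOf (d := d)) continuous_xOf
    have h3 := continuous_ip (continuous_const (y := sampleMean d h n)) (continuous_xOf (d := d))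
    have h4 := continuous_ip (continuous_const (y := sampleStd d h n)) (continuous_yOf (d := d))
    exact (by fun_prop : Continuous fun a : Fin d ⊕ Fin d → ℝ => Real.exp (n *
      (β / 2 * ip (xOf a) (xOf a) + β * ip (sampleMean d h n) (xOf a) +
        β * ip (sampleStd d h n) (yOf a)))).measurable.ennreal_ofReal
  have huniv : ρ Set.univ = c * R Set.univ := by
    have h1 : ρ Set.univ = ρ.map Subtype.val Set.univ := by
      rw [Measure.map_apply hval MeasurableSet.univ, Set.preimage_univ]
    rw [h1, hmap, Measure.smul_apply, Measure.map_apply hc MeasurableSet.univ, Set.preimage_univ,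
      ← Set.univ_prod_univ, Measure.prod_prod, measure_univ (μ := γ), mul_one, smul_eq_mul]
  have hgibbs : gibbs d n β h =
      ((ρ Set.univ)⁻¹ • ρ).map fun Ωp => extendCfg d n Ωp.val := rfl
  have hcomp : (ρ.map fun Ωp => extendCfg d n Ωp.val) = (ρ.map Subtype.val).map (extendCfg d n) :=
    (Measure.map_map measurable_extendCfg hval).symm
  have hcomp2 : ((R.prod γ).map fun p => extendCfg d n (coneVec b p)) =
      ((R.prod γ).map (coneVec b)).map (extendCfg d n) :=
    (Measure.map_map measurable_extendCfg hc).symm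
  rw [hgibbs, Measure.map_smul, hcomp, hmap, Measure.map_smul, ← hcomp2, smul_smul, huniv,
    paramLaw, ← hR, Measure.prod_smul_left, Measure.map_smul]
  congr 1
  rw [ENNReal.mul_inv (Or.inl hc0) (Or.inl hct), mul_right_comm, ENNReal.inv_mul_cancel hc0 hct,
    one_mul]

end GibbsRepresentation

section GaussianLaw

open ProbabilityTheory

variable {κ l E : Type*} [Fintype κ] [Fintype l] [NormedAddCommGroup E] [InnerProductSpace ℝ E]

lemma map_sumVec_gaussian [FiniteDimensional ℝ E] [MeasurableSpace E] [BorelSpace E]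
    (b : OrthonormalBasis (κ ⊕ l) ℝ E) :
    ((Measure.pi fun _ : κ => gaussianReal 0 1).prod
      (Measure.pi fun _ : l => gaussianReal 0 1)).map (sumVec b) = stdGaussian E := by
  rw [stdGaussian_eq_map_pi_orthonormalBasis b,
    ← (measurePreserving_sumPiEquivProdPi_symm
      (fun _ : κ ⊕ l => (gaussianReal 0 1 : Measure ℝ))).map_eq, Measure.map_map]
  · congr 1
    ext1 p
    simp [sumVec, MeasurableEquiv.sumPiEquivProdPi, Equiv.sumPiEquivProdPi]
  · fun_prop
  · exact MeasurableEquiv.measurable _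

lemma map_curry_pi {ι ι' : Type*} [Fintype ι] [Fintype ι'] (μ : ι → ι' → Measure ℝ)
    [∀ i j, IsProbabilityMeasure (μ i j)] :
    (Measure.pi fun p : ι × ι' => μ p.1 p.2).map Function.curry =
      Measure.pi fun i => Measure.pi fun j => μ i j := by
  have h := Measure.infinitePi_map_curry μ
  simp only [Measure.infinitePi_eq_pi] at h
  exact h

lemma map_affine_sumVec {n d : ℕ}
    (b : OrthonormalBasis (κ ⊕ l) ℝ (EuclideanSpace ℝ (Fin n × Fin d)))
    (mean : Fin n → Fin d → ℝ) (v : NNReal) :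
    ((Measure.pi fun _ : κ => gaussianReal 0 1).prod
      (Measure.pi fun _ : l => gaussianReal 0 1)).map
        (fun p i j => mean i j + √v * sumVec b p (i, j)) =
      Measure.pi fun i => Measure.pi fun j => gaussianReal (mean i j) v := by
  have hf : Measurable fun (u : EuclideanSpace ℝ (Fin n × Fin d)) i j =>
      mean i j + √v * u (i, j) :=
    measurable_pi_lambda _ fun i => measurable_pi_lambda _ fun j => by fun_prop
  have hg (i : Fin n) (j : Fin d) : (gaussianReal 0 1).map (fun x => mean i j + √v * x) =
      gaussianReal (mean i j) v := by
    have h1 : (fun x => mean i j + √v * x) = (mean i j + ·) ∘ (√v * ·) := rfl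
    rw [h1, ← Measure.map_map (by fun_prop) (by fun_prop), gaussianReal_map_const_mul,
      gaussianReal_map_const_add]
    congr 1
    · simp
    · ext
      simp
  have hp := Measure.pi_map_pi (μ := fun _ : Fin n × Fin d => (gaussianReal 0 1 : Measure ℝ))
    (f := fun p x => mean p.1 p.2 + √v * x) (fun p => by fun_prop)
    (hμ := fun p => by rw [hg]; infer_instance)
  simp only [hg] at hp
  have hfac : (fun p i j => mean i j + √v * sumVec b p (i, j)) =
      (fun (u : EuclideanSpace ℝ (Fin n × Fin d)) i j => mean i j + √v * u (i, j)) ∘ sumVec b := rfl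
  rw [hfac, ← Measure.map_map hf (by fun_prop), map_sumVec_gaussian, ← map_pi_eq_stdGaussian,
    Measure.map_map hf (by fun_prop), ← map_curry_pi, ← hp, Measure.map_map (by fun_prop)]
  · rfl
  · exact measurable_pi_lambda _ fun p => by fun_prop

end GaussianLaw

section GaussianMoments

open ProbabilityTheory

variable {l : Type*} [Fintype l]

lemma memLp_sum_comp_eval {μ : Measure ℝ} [IsProbabilityMeasure μ] {f : l → ℝ → ℝ}
    (hf : ∀ k, MemLp (f k) 2 μ) :
    MemLp (fun η : l → ℝ => ∑ k, f k (η k)) 2 (Measure.pi fun _ => μ) :=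
  memLp_finsetSum _ fun k _ =>
    (hf k).comp_measurePreserving (measurePreserving_eval (fun _ : l => μ) k)

lemma integral_sum_comp_eval_sq {μ : Measure ℝ} [IsProbabilityMeasure μ] {f : l → ℝ → ℝ}
    (hf : ∀ k, MemLp (f k) 2 μ) (h0 : ∀ k, ∫ x, f k x ∂μ = 0) :
    ∫ η : l → ℝ, (∑ k, f k (η k)) ^ 2 ∂(Measure.pi fun _ => μ) = ∑ k, ∫ x, f k x ^ 2 ∂μ := by
  have hm := memLp_sum_comp_eval hf
  have h1 : ∫ η : l → ℝ, ∑ k, f k (η k) ∂(Measure.pi fun _ => μ) = 0 := by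
    rw [integral_finsetSum _ fun k _ => integrable_comp_eval ((hf k).integrable one_le_two)]
    refine Finset.sum_eq_zero fun k _ => ?_
    rw [integral_comp_eval (μ := fun _ : l => μ) (hf k).aestronglyMeasurable, h0 k]
  rw [← variance_of_integral_eq_zero hm.aestronglyMeasurable.aemeasurable h1]
  have h2 := variance_sum_pi (μ := fun _ : l => μ) hf
  have h3 : (∑ i, fun ω : l → ℝ => f i (ω i)) = fun η => ∑ k, f k (η k) := by
    ext η
    simp
  rw [h3] at h2
  rw [h2]
  exact Finset.sum_congr rfl fun k _ =>
    variance_of_integral_eq_zero (hf k).aestronglyMeasurable.aemeasurable (h0 k)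

lemma memLp_id_gaussian : MemLp (fun x : ℝ => x) 2 (gaussianReal 0 1) :=
  memLp_id_gaussianReal' 2 (by simp)

lemma integral_sq_gaussian : ∫ x, x ^ 2 ∂(gaussianReal 0 1) = 1 := by
  have h := variance_of_integral_eq_zero (X := fun x : ℝ => x) (μ := gaussianReal 0 1)
    aemeasurable_id (by simp)
  rw [← h]
  simp

lemma memLp_linear_gaussian (c : l → ℝ) : MemLp (fun η : l → ℝ => ∑ k, η k * c k) 2
    (Measure.pi fun _ => gaussianReal 0 1) :=
  memLp_sum_comp_eval fun k => memLp_id_gaussian.mul_const (c k)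

lemma integral_linear_sq_gaussian (c : l → ℝ) : ∫ η : l → ℝ, (∑ k, η k * c k) ^ 2
    ∂(Measure.pi fun _ => gaussianReal 0 1) = sqLen c := by
  rw [integral_sum_comp_eval_sq (f := fun k x => x * c k) fun k => memLp_id_gaussian.mul_const (c k)]
  · simp_rw [mul_pow, integral_mul_const, integral_sq_gaussian, one_mul]
    rfl
  · intro k
    rw [integral_mul_const]
    simp

lemma memLp_sq_sub_one_gaussian : MemLp (fun x : ℝ => x ^ 2 - 1) 2 (gaussianReal 0 1) := by
  refine MemLp.sub ?_ (memLp_const _)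
  have h := (memLp_id_gaussianReal' (μ := 0) (v := 1) 4 (by simp)).norm_rpow_div 2
  have h4 : (4 : ENNReal) / 2 = 2 := by
    rw [show (4 : ENNReal) = 2 * 2 by norm_num]
    exact ENNReal.mul_div_cancel_right (by simp) (by simp)
  rw [h4] at h
  simpa using h

lemma memLp_sqLen_sub_card : MemLp (fun η : l → ℝ => sqLen η - Fintype.card l) 2
    (Measure.pi fun _ => gaussianReal 0 1) := by
  have h := memLp_sum_comp_eval (l := l) fun _ => memLp_sq_sub_one_gaussian
  simpa [sqLen] using h

lemma integral_sqLen_sub_card_sq : ∫ η : l → ℝ, (sqLen η - Fintype.card l) ^ 2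
    ∂(Measure.pi fun _ => gaussianReal 0 1) =
      Fintype.card l * ∫ x, (x ^ 2 - 1) ^ 2 ∂(gaussianReal 0 1) := by
  have h := integral_sum_comp_eval_sq (l := l) (μ := gaussianReal 0 1)
    (f := fun _ x => x ^ 2 - 1) (fun _ => memLp_sq_sub_one_gaussian) fun _ => by
      rw [integral_sub memLp_id_gaussian.integrable_sq (integrable_const _), integral_sq_gaussian]
      simp
  simpa [sqLen] using h

end GaussianMoments

section Coupling

lemma abs_sqrt_sub_div_le {N R : ℝ} (hN : 0 < N) (hR0 : 0 ≤ R) (hR : N / 4 ≤ R ^ 2) :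
    |√N - R| / R ≤ 4 / 3 * (|N - R ^ 2| / N) := by
  have hsN : √N ^ 2 = N := Real.sq_sqrt hN.le
  have hsN0 : 0 < √N := Real.sqrt_pos.2 hN
  have hR1 : √N / 2 ≤ R := by
    refine le_of_sq_le_sq ?_ hR0
    rw [div_pow, hsN]
    linarith
  have hRp : 0 < R := by linarith
  have h1 : |N - R ^ 2| = |√N - R| * (√N + R) := by
    rw [← abs_of_pos (by linarith : 0 < √N + R), ← abs_mul]
    congr 1
    linear_combination -hsN
  rw [h1, div_le_iff₀ hRp]
  have h2 : 4 / 3 * (|√N - R| * (√N + R) / N) * R = |√N - R| * (4 / 3 * ((√N + R) * R) / N) := by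
    ring
  rw [h2]
  refine le_mul_of_one_le_right (abs_nonneg _) ?_
  rw [le_div_iff₀ hN]
  nlinarith

lemma min_abs_coupling_le {X Y x y A A' c c' Q R ε z z' r δ : ℝ} (hr : 1 ≤ r) (hδ : 1 ≤ δ)
    (hA : |A| ≤ 1) (hA' : |A'| ≤ 1) (hR : 0 ≤ R) (hε : 0 < ε) (hε' : ε ≤ 1 / 2) :
    min |X + c * Y + A * (r * (R⁻¹ * Q)) -
        (x + y * c' + A' / δ * (z / r + c * (z' / r) + Q))| 1 ≤
      |X - x| + |c| * |Y - y| + |y| * |c - c'| + |A - A'| * ((1 + Q ^ 2) / 2) +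
        (ε * Q ^ 2 + ((r * δ) ^ 2 - R ^ 2) ^ 2 / ((r * δ) ^ 2) ^ 2 / ε +
        ((1 + z ^ 2) / 2 + |c| * ((1 + z' ^ 2) / 2)) / r) := by
  have habs (t : ℝ) : |t| ≤ (1 + t ^ 2) / 2 := by
    nlinarith [sq_nonneg (|t| - 1), sq_abs t]
  have hr0 : 0 < r := by linarith
  have hδ0 : 0 < δ := by linarith
  set N := (r * δ) ^ 2 with hN
  have hN0 : 0 < N := by positivity
  have hsq : √N = r * δ := Real.sqrt_sq (by positivity)
  have n1 : 0 ≤ |A - A'| * ((1 + Q ^ 2) / 2) := by positivity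
  have n2 : 0 ≤ ((1 + z ^ 2) / 2 + |c| * ((1 + z' ^ 2) / 2)) / r := by positivity
  have n3 : 0 ≤ |X - x| + |c| * |Y - y| + |y| * |c - c'| := by positivity
  have hAδ : |A' / δ| ≤ 1 := by
    rw [abs_div, abs_of_pos hδ0, div_le_one hδ0]
    linarith
  have hδi : |δ⁻¹| ≤ 1 := by
    rw [abs_of_pos (inv_pos.2 hδ0)]
    exact inv_le_one_of_one_le₀ hδ
  rcases le_or_gt (N / 4) (R ^ 2) with h | h
  · refine (min_le_left _ _).trans ?_
    have hRp : 0 < R := by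
      rcases hR.eq_or_lt with h0 | h0
      · rw [← h0] at h
        norm_num at h
        linarith
      · exact h0
    have hid : X + c * Y + A * (r * (R⁻¹ * Q)) -
        (x + y * c' + A' / δ * (z / r + c * (z' / r) + Q)) =
        (X - x) + c * (Y - y) + y * (c - c') + δ⁻¹ * ((A - A') * Q) +
          δ⁻¹ * (A * (Q * ((√N - R) / R))) + -(A' / δ * ((z + c * z') / r)) := by
      rw [hsq]
      field_simp
      ring
    rw [hid]
    have b1 : |δ⁻¹ * ((A - A') * Q)| ≤ |A - A'| * ((1 + Q ^ 2) / 2) := by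
      rw [abs_mul, abs_mul]
      refine (mul_le_of_le_one_left (by positivity) hδi).trans ?_
      gcongr
      exact habs Q
    have b2 : |δ⁻¹ * (A * (Q * ((√N - R) / R)))| ≤
        ε * Q ^ 2 + (N - R ^ 2) ^ 2 / N ^ 2 / ε := by
      rw [abs_mul, abs_mul, abs_mul, abs_div, abs_of_pos hRp]
      refine (mul_le_of_le_one_left (by positivity) hδi).trans ?_
      refine (mul_le_of_le_one_left (by positivity) hA).trans ?_
      refine (mul_le_mul_of_nonneg_left (abs_sqrt_sub_div_le hN0 hR h) (abs_nonneg _)).trans ?_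
      set t := |N - R ^ 2| / N with ht
      have ht2 : (N - R ^ 2) ^ 2 / N ^ 2 = t ^ 2 := by rw [ht, div_pow, sq_abs]
      rw [ht2, ← sq_abs Q, ← sub_nonneg]
      have : ε * |Q| ^ 2 + t ^ 2 / ε - |Q| * (4 / 3 * t) =
          ((ε * |Q| - 2 / 3 * t) ^ 2 + 5 / 9 * t ^ 2) / ε := by
        field_simp
        ring
      rw [this]
      positivity
    have b3 : |-(A' / δ * ((z + c * z') / r))| ≤
        ((1 + z ^ 2) / 2 + |c| * ((1 + z' ^ 2) / 2)) / r := by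
      rw [abs_neg, abs_mul, abs_div (z + c * z'), abs_of_pos hr0]
      refine (mul_le_of_le_one_left (by positivity) hAδ).trans ?_
      gcongr
      refine (abs_add_le _ _).trans ?_
      rw [abs_mul]
      gcongr
      · exact habs z
      · exact habs z'
    have b4 : |c * (Y - y)| = |c| * |Y - y| := abs_mul _ _
    have b5 : |y * (c - c')| = |y| * |c - c'| := abs_mul _ _
    refine (abs_add_le _ _).trans ?_
    have e1 := abs_add_le ((X - x) + c * (Y - y) + y * (c - c') + δ⁻¹ * ((A - A') * Q))
      (δ⁻¹ * (A * (Q * ((√N - R) / R))))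
    have e2 := abs_add_le ((X - x) + c * (Y - y) + y * (c - c')) (δ⁻¹ * ((A - A') * Q))
    have e3 := abs_add_le ((X - x) + c * (Y - y)) (y * (c - c'))
    have e4 := abs_add_le (X - x) (c * (Y - y))
    linarith
  · refine (min_le_right _ _).trans ?_
    have h1 : 9 / 16 ≤ (N - R ^ 2) ^ 2 / N ^ 2 := by
      rw [le_div_iff₀ (by positivity)]
      nlinarith
    have h2 : 1 ≤ (N - R ^ 2) ^ 2 / N ^ 2 / ε := by
      rw [le_div_iff₀ hε]
      linarith
    have h3 : 0 ≤ ε * Q ^ 2 := by positivity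
    linarith

end Coupling

section Components

open ProbabilityTheory

variable {d n : ℕ} {l : Type*} [Fintype l]
  {b : OrthonormalBasis ((Fin d ⊕ Fin d) ⊕ l) ℝ (EuclideanSpace ℝ (Fin n × Fin d))}
  {h : ℕ → Fin d → ℝ}

lemma sumVec_apply (hb : ∀ k, b (Sum.inl k) = fieldVec d n h k)
    (p : (Fin d ⊕ Fin d → ℝ) × (l → ℝ)) (i : Fin n) (j : Fin d) :
    sumVec b p (i, j) = p.1 (Sum.inl j) / √n +
      (h i j - sampleMean d h n j) / sampleStd d h n j * (p.1 (Sum.inr j) / √n) +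
      ∑ k, p.2 k * b (Sum.inr k) (i, j) := by
  simp only [sumVec, hb, fieldVec, colVec, Fintype.sum_sum_type, Sum.elim_inl, Sum.elim_inr,
    PiLp.add_apply, PiLp.smul_apply, WithLp.ofLp_sum, Finset.sum_apply, smul_eq_mul, mul_ite,
    mul_zero, Finset.sum_ite_eq, Finset.mem_univ, if_true]
  ring

lemma extendCfg_coneVec_apply (hb : ∀ k, b (Sum.inl k) = fieldVec d n h k)
    (p : (Fin d ⊕ Fin d → ℝ) × (l → ℝ)) (i : Fin n) (j : Fin d) :
    extendCfg d n (coneVec b p) i j = xOf p.1 j +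
      (h i j - sampleMean d h n j) / sampleStd d h n j * yOf p.1 j +
      (√(1 + sqLen p.1))⁻¹ *
        (√n * ((√(sqLen p.2))⁻¹ * ∑ k, p.2 k * b (Sum.inr k) (i, j))) := by
  have hn : √(n : ℝ) ≠ 0 := by
    have : 0 < n := i.pos
    positivity
  rw [extendCfg, dif_pos i.isLt, coneVec, PiLp.smul_apply, sumVec_apply hb, Finset.mul_sum]
  simp only [Pi.smul_apply, smul_eq_mul, xOf, yOf, mul_assoc]
  field_simp

lemma sqLen_basis_le (b : OrthonormalBasis ((Fin d ⊕ Fin d) ⊕ l) ℝ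
    (EuclideanSpace ℝ (Fin n × Fin d))) (i : Fin n) (j : Fin d) :
    sqLen (fun k => b (Sum.inr k) (i, j)) ≤ 1 := by
  classical
  have h1 := b.sum_sq_inner_right (EuclideanSpace.single (i, j) 1)
  have h2 : ‖(EuclideanSpace.single (i, j) (1 : ℝ) : EuclideanSpace ℝ (Fin n × Fin d))‖ = 1 := by
    simp
  rw [h2, Fintype.sum_sum_type] at h1
  simp only [EuclideanSpace.inner_single_right, one_mul, conj_trivial] at h1
  have h3 : 0 ≤ ∑ k, (b (Sum.inl k) (i, j)) ^ 2 := Finset.sum_nonneg fun _ _ => sq_nonneg _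
  unfold sqLen
  linarith

end Components

section CouplingIntegral

open ProbabilityTheory

lemma integral_fst_add_mul_add_snd_le {X Y : Type*} [MeasurableSpace X] [MeasurableSpace Y]
    {μ : Measure X} {ν : Measure Y} [IsProbabilityMeasure μ] [IsProbabilityMeasure ν]
    {F : X × Y → ℝ} {f₁ f₂ : X → ℝ} {g k : Y → ℝ} (hF : ∀ p, 0 ≤ F p)
    (hle : ∀ p, F p ≤ f₁ p.1 + f₂ p.1 * g p.2 + k p.2) (h₁ : Integrable f₁ μ)
    (h₂ : Integrable f₂ μ) (hg : Integrable g ν) (hk : Integrable k ν) :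
    ∫ p, F p ∂(μ.prod ν) ≤ ∫ x, f₁ x ∂μ + (∫ x, f₂ x ∂μ) * ∫ y, g y ∂ν + ∫ y, k y ∂ν := by
  have i1 : Integrable (fun p : X × Y => f₁ p.1) (μ.prod ν) := h₁.comp_fst ν
  have i2 : Integrable (fun p : X × Y => f₂ p.1 * g p.2) (μ.prod ν) := h₂.mul_prod hg
  have i3 : Integrable (fun p : X × Y => k p.2) (μ.prod ν) := hk.comp_snd μ
  refine (integral_mono_of_nonneg (ae_of_all _ hF) ((i1.fun_add i2).fun_add i3) (ae_of_all _ hle)).trans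
    (le_of_eq ?_)
  rw [integral_add (i1.fun_add i2) i3, integral_add i1 i2, integral_prod_mul, integral_fun_fst,
    integral_fun_snd]
  simp

variable {d n : ℕ} {l : Type*} [Fintype l]
  {b : OrthonormalBasis ((Fin d ⊕ Fin d) ⊕ l) ℝ (EuclideanSpace ℝ (Fin n × Fin d))}
  {h : ℕ → Fin d → ℝ}

lemma integrable_abs_xOf_sub (τ : Measure (Fin d ⊕ Fin d → ℝ)) [IsProbabilityMeasure τ]
    (x : ℝ) (j : Fin d) : Integrable (fun a => |xOf a j - x|) τ := by
  refine Integrable.of_bound (C := 1 + |x|) (by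
    have := continuous_xOf (d := d)
    exact (by fun_prop : Continuous fun a : Fin d ⊕ Fin d → ℝ =>
      |xOf a j - x|).aestronglyMeasurable) (ae_of_all _ fun a => ?_)
  rw [Real.norm_eq_abs, abs_abs]
  exact (abs_sub _ _).trans (by linarith [abs_xOf_le a j])

lemma integrable_abs_yOf_sub (τ : Measure (Fin d ⊕ Fin d → ℝ)) [IsProbabilityMeasure τ]
    (y : ℝ) (j : Fin d) : Integrable (fun a => |yOf a j - y|) τ := by
  refine Integrable.of_bound (C := 1 + |y|) (by
    have := continuous_yOf (d := d)
    exact (by fun_prop : Continuous fun a : Fin d ⊕ Fin d → ℝ =>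
      |yOf a j - y|).aestronglyMeasurable) (ae_of_all _ fun a => ?_)
  rw [Real.norm_eq_abs, abs_abs]
  exact (abs_sub _ _).trans (by linarith [abs_yOf_le a j])

lemma inv_sqrt_one_add_sqLen_mem {κ : Type*} [Fintype κ] (a : κ → ℝ) :
    |(√(1 + sqLen a))⁻¹| ≤ 1 := by
  rw [abs_of_pos (inv_pos.2 (sqrt_one_add_sqLen_pos a))]
  refine inv_le_one_of_one_le₀ (Real.one_le_sqrt.2 ?_)
  linarith [sqLen_nonneg a]

lemma continuous_inv_sqrt_one_add_sqLen {κ : Type*} [Fintype κ] :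
    Continuous fun a : κ → ℝ => (√(1 + sqLen a))⁻¹ :=
  Continuous.inv₀ (by fun_prop) fun a => (sqrt_one_add_sqLen_pos a).ne'

lemma integrable_abs_inv_sqrt_sub {κ : Type*} [Fintype κ] (τ : Measure (κ → ℝ))
    [IsProbabilityMeasure τ] (t : ℝ) :
    Integrable (fun a => |(√(1 + sqLen a))⁻¹ - t|) τ := by
  refine Integrable.of_bound (C := 1 + |t|)
    ((continuous_inv_sqrt_one_add_sqLen.sub continuous_const).abs.aestronglyMeasurable)
    (ae_of_all _ fun a => ?_)
  rw [Real.norm_eq_abs, abs_abs]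
  exact (abs_sub _ _).trans (by linarith [inv_sqrt_one_add_sqLen_mem a])

lemma integral_remainder_le {κ : Type*} [Fintype κ] (e : l → ℝ) (he : sqLen e ≤ 1) (k k' : κ)
    (c : ℝ) (hd : 1 ≤ d) (hn : 1 ≤ n) (hcard : Fintype.card l + 2 * d = n * d) :
    Integrable (fun q : (κ → ℝ) × (l → ℝ) => (2 * √n)⁻¹ * (∑ k, q.2 k * e k) ^ 2 +
      ((n * d : ℝ) - sqLen q.2) ^ 2 / (n * d : ℝ) ^ 2 / (2 * √n)⁻¹ +
      ((1 + q.1 k ^ 2) / 2 + |c| * ((1 + q.1 k' ^ 2) / 2)) / √n)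
      ((Measure.pi fun _ : κ => gaussianReal 0 1).prod (Measure.pi fun _ : l => gaussianReal 0 1)) ∧
    ∫ q : (κ → ℝ) × (l → ℝ), ((2 * √n)⁻¹ * (∑ k, q.2 k * e k) ^ 2 +
      ((n * d : ℝ) - sqLen q.2) ^ 2 / (n * d : ℝ) ^ 2 / (2 * √n)⁻¹ +
      ((1 + q.1 k ^ 2) / 2 + |c| * ((1 + q.1 k' ^ 2) / 2)) / √n)
      ∂((Measure.pi fun _ : κ => gaussianReal 0 1).prod
        (Measure.pi fun _ : l => gaussianReal 0 1)) ≤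
      (16 * d ^ 2 + 4 * ∫ x, (x ^ 2 - 1) ^ 2 ∂(gaussianReal 0 1) + 2 + |c|) / √n := by
  set γ := Measure.pi fun _ : κ => gaussianReal 0 1
  set γ' := Measure.pi fun _ : l => gaussianReal 0 1
  set c0 := ∫ x, (x ^ 2 - 1) ^ 2 ∂(gaussianReal 0 1)
  have hc0 : 0 ≤ c0 := integral_nonneg fun _ => sq_nonneg _
  have hn0 : (1 : ℝ) ≤ n := by exact_mod_cast hn
  have hd0 : (1 : ℝ) ≤ d := by exact_mod_cast hd
  have hr0 : 0 < √(n : ℝ) := Real.sqrt_pos.2 (by linarith)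
  have hr2 : √(n : ℝ) * √n = n := Real.mul_self_sqrt (by linarith)
  have hcr : (Fintype.card l : ℝ) + 2 * d = n * d := by exact_mod_cast hcard
  have i1 : Integrable (fun q : (κ → ℝ) × (l → ℝ) => (∑ k, q.2 k * e k) ^ 2) (γ.prod γ') :=
    (memLp_linear_gaussian e).integrable_sq.comp_snd γ
  have e1 : ∫ q : (κ → ℝ) × (l → ℝ), (∑ k, q.2 k * e k) ^ 2 ∂(γ.prod γ') ≤ 1 := by
    rw [integral_fun_snd (fun η : l → ℝ => (∑ k, η k * e k) ^ 2), integral_linear_sq_gaussian]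
    simpa using he
  have i2 : Integrable (fun q : (κ → ℝ) × (l → ℝ) => (sqLen q.2 - Fintype.card l) ^ 2)
      (γ.prod γ') := memLp_sqLen_sub_card.integrable_sq.comp_snd γ
  have e2 : ∫ q : (κ → ℝ) × (l → ℝ), (sqLen q.2 - Fintype.card l) ^ 2 ∂(γ.prod γ') =
      Fintype.card l * c0 := by
    rw [integral_fun_snd (fun η : l → ℝ => (sqLen η - Fintype.card l) ^ 2),
      integral_sqLen_sub_card_sq]
    simp [c0]
  have i3 : Integrable (fun q : (κ → ℝ) × (l → ℝ) => ((n * d : ℝ) - sqLen q.2) ^ 2)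
      (γ.prod γ') := by
    have : MemLp (fun η : l → ℝ => sqLen η - n * d) 2 γ' := by
      convert! (memLp_sqLen_sub_card (l := l)).sub (memLp_const (2 * (d : ℝ))) using 1
      ext η
      simp only [Pi.sub_apply]
      linarith
    refine (this.integrable_sq.comp_snd γ).congr (ae_of_all _ fun q => ?_)
    ring
  have e3 : ∫ q : (κ → ℝ) × (l → ℝ), ((n * d : ℝ) - sqLen q.2) ^ 2 ∂(γ.prod γ') ≤
      8 * d ^ 2 + 2 * (n * d * c0) := by
    refine (integral_mono i3 ((integrable_const (8 * (d : ℝ) ^ 2)).fun_add (i2.const_mul 2)) fun q => ?_).trans ?_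
    · simp only [← hcr]
      nlinarith [sq_nonneg (2 * (d : ℝ) + (sqLen q.2 - Fintype.card l))]
    · rw [integral_add (integrable_const _) (i2.const_mul 2),
        integral_const_mul (2 : ℝ) fun q : (κ → ℝ) × (l → ℝ) => (sqLen q.2 - Fintype.card l) ^ 2, e2]
      simp only [integral_const, probReal_univ, one_smul]
      have : (Fintype.card l : ℝ) * c0 ≤ n * d * c0 :=
        mul_le_mul_of_nonneg_right (by linarith) hc0
      linarith
  have i4 (k : κ) : Integrable (fun q : (κ → ℝ) × (l → ℝ) => q.1 k ^ 2) (γ.prod γ') := by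
    have h1 : Integrable (fun ζ : κ → ℝ => ζ k ^ 2) γ :=
      integrable_comp_eval (μ := fun _ : κ => gaussianReal 0 1) (f := fun x : ℝ => x ^ 2)
        memLp_id_gaussian.integrable_sq
    exact h1.comp_fst γ'
  have e4 (k : κ) : ∫ q : (κ → ℝ) × (l → ℝ), q.1 k ^ 2 ∂(γ.prod γ') = 1 := by
    rw [integral_fun_fst (fun ζ : κ → ℝ => ζ k ^ 2),
      integral_comp_eval (μ := fun _ : κ => gaussianReal 0 1) (f := fun x : ℝ => x ^ 2)
        memLp_id_gaussian.integrable_sq.aestronglyMeasurable, integral_sq_gaussian]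
    simp
  have j1 := i1.const_mul (2 * √(n : ℝ))⁻¹
  have j2 := (i3.div_const ((n * d : ℝ) ^ 2)).div_const (2 * √(n : ℝ))⁻¹
  have j3 (k : κ) := ((integrable_const (1 : ℝ)).fun_add (i4 k)).div_const 2
  have j4 := ((j3 k).fun_add ((j3 k').const_mul |c|)).div_const √(n : ℝ)
  refine ⟨(j1.fun_add j2).fun_add j4, ?_⟩
  have s3 (k : κ) : ∫ q : (κ → ℝ) × (l → ℝ), (1 + q.1 k ^ 2) / 2 ∂(γ.prod γ') = 1 := by
    rw [integral_div, integral_add (integrable_const _) (i4 k), e4]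
    simp
  have s4 : ∫ q : (κ → ℝ) × (l → ℝ), ((1 + q.1 k ^ 2) / 2 + |c| * ((1 + q.1 k' ^ 2) / 2)) / √n
      ∂(γ.prod γ') = (1 + |c|) / √n := by
    rw [integral_div, integral_add (j3 k) ((j3 k').const_mul |c|), integral_const_mul, s3, s3,
      mul_one]
  have s12 : ∫ q : (κ → ℝ) × (l → ℝ), ((2 * √n)⁻¹ * (∑ k, q.2 k * e k) ^ 2 +
      ((n * d : ℝ) - sqLen q.2) ^ 2 / (n * d : ℝ) ^ 2 / (2 * √n)⁻¹) ∂(γ.prod γ') ≤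
      (2 * √n)⁻¹ + (8 * d ^ 2 + 2 * (n * d * c0)) / (n * d : ℝ) ^ 2 / (2 * √n)⁻¹ := by
    rw [integral_add j1 j2, integral_const_mul, integral_div, integral_div]
    gcongr
    exact mul_le_of_le_one_right (by positivity) e1
  rw [integral_add (j1.fun_add j2) j4, s4]
  refine (add_le_add_left s12 _).trans ?_
  have h5 : (8 * (d : ℝ) ^ 2 + 2 * (n * d * c0)) / (n * d : ℝ) ^ 2 / (2 * √n)⁻¹ ≤
      (16 * d ^ 2 + 4 * c0) / √n := by
    rw [div_inv_eq_mul, le_div_iff₀ hr0, mul_assoc _ (2 * √(n : ℝ)), mul_assoc 2, hr2, div_mul_eq_mul_div,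
      div_le_iff₀ (by positivity)]
    have hnd : (n : ℝ) ≤ n * d := le_mul_of_one_le_right (by linarith) hd0
    have h6 : (n : ℝ) ≤ (n * d) ^ 2 := by nlinarith
    have h7 : n * ((n * d : ℝ) * c0) ≤ (n * d) ^ 2 * c0 := by
      have : n * (n * d : ℝ) ≤ (n * d) ^ 2 := by nlinarith
      nlinarith
    nlinarith [mul_le_mul_of_nonneg_left h6 (sq_nonneg (d : ℝ))]
  have h6 : (2 * √(n : ℝ))⁻¹ ≤ 1 / √n := by
    rw [mul_inv, one_div]
    have := inv_pos.2 hr0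
    linarith
  have h7 : (16 * (d : ℝ) ^ 2 + 4 * c0 + 2 + |c|) / √n =
      1 / √n + (16 * d ^ 2 + 4 * c0) / √n + (1 + |c|) / √n := by ring
  rw [h7]
  linarith

end CouplingIntegral

section CouplingLimit

open ProbabilityTheory

variable {d n : ℕ} {l : Type*} [Fintype l]
  {b : OrthonormalBasis ((Fin d ⊕ Fin d) ⊕ l) ℝ (EuclideanSpace ℝ (Fin n × Fin d))}
  {h : ℕ → Fin d → ℝ}

lemma integral_coupling_le (hd : 1 ≤ d) (hcard : Fintype.card l + 2 * d = n * d)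
    (hb : ∀ k, b (Sum.inl k) = fieldVec d n h k) {m s x y : Fin d → ℝ} (hxy : inBall d x y)
    (τ : Measure (Fin d ⊕ Fin d → ℝ)) [IsProbabilityMeasure τ] (i : Fin n) (j : Fin d) :
    ∫ p, min |extendCfg d n (coneVec b (p.1, p.2.2)) i j -
        (pureMean d h m s x y i j + √(pureVar d x y) * sumVec b p.2 (i, j))| 1
      ∂(τ.prod ((Measure.pi fun _ : Fin d ⊕ Fin d => gaussianReal 0 1).prod
        (Measure.pi fun _ : l => gaussianReal 0 1))) ≤
      ∫ a, |xOf a j - x j| ∂τ +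
        |(h i j - sampleMean d h n j) / sampleStd d h n j| * ∫ a, |yOf a j - y j| ∂τ +
        |y j| * |(h i j - sampleMean d h n j) / sampleStd d h n j - (h i j - m j) / s j| +
        ∫ a, |(√(1 + sqLen a))⁻¹ - √(1 - ip x x - ip y y)| ∂τ +
        (16 * d ^ 2 + 4 * ∫ x, (x ^ 2 - 1) ^ 2 ∂(gaussianReal 0 1) + 2 +
          |(h i j - sampleMean d h n j) / sampleStd d h n j|) / √n := by
  set c := (h i j - sampleMean d h n j) / sampleStd d h n j
  set c' := (h i j - m j) / s j
  set e : l → ℝ := fun k => b (Sum.inr k) (i, j)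
  have he : sqLen e ≤ 1 := sqLen_basis_le b i j
  have hn : 1 ≤ n := i.pos
  have hn0 : (1 : ℝ) ≤ n := by exact_mod_cast hn
  have hd0 : (1 : ℝ) ≤ d := by exact_mod_cast hd
  have hr : 1 ≤ √(n : ℝ) := Real.one_le_sqrt.2 hn0
  have hδ : 1 ≤ √(d : ℝ) := Real.one_le_sqrt.2 hd0
  have hV : 0 < 1 - ip x x - ip y y := by
    unfold inBall at hxy
    linarith
  have hV1 : 1 - ip x x - ip y y ≤ 1 := by linarith [ip_self_nonneg x, ip_self_nonneg y]
  have hA' : |√(1 - ip x x - ip y y)| ≤ 1 := by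
    rw [abs_of_nonneg (Real.sqrt_nonneg _)]
    exact Real.sqrt_le_one.2 hV1
  have hv : √(pureVar d x y : ℝ) = √(1 - ip x x - ip y y) / √d := by
    rw [pureVar, Real.coe_toNNReal _ (by positivity), Real.sqrt_div hV.le]
  have hrd : (√(n : ℝ) * √d) ^ 2 = n * d := by
    rw [mul_pow, Real.sq_sqrt (by linarith), Real.sq_sqrt (by linarith)]
  obtain ⟨hk, hk'⟩ := integral_remainder_le e he (Sum.inl j : Fin d ⊕ Fin d) (Sum.inr j) c hd hn
    hcard
  have hg : Integrable (fun q : (Fin d ⊕ Fin d → ℝ) × (l → ℝ) => (1 + (∑ k, q.2 k * e k) ^ 2) / 2)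
      ((Measure.pi fun _ : Fin d ⊕ Fin d => gaussianReal 0 1).prod
        (Measure.pi fun _ : l => gaussianReal 0 1)) :=
    ((integrable_const (1 : ℝ)).fun_add
      ((memLp_linear_gaussian e).integrable_sq.comp_snd _)).div_const 2
  have hg' : ∫ q : (Fin d ⊕ Fin d → ℝ) × (l → ℝ), (1 + (∑ k, q.2 k * e k) ^ 2) / 2
      ∂((Measure.pi fun _ : Fin d ⊕ Fin d => gaussianReal 0 1).prod
        (Measure.pi fun _ : l => gaussianReal 0 1)) ≤ 1 := by
    rw [integral_fun_snd (fun η : l → ℝ => (1 + (∑ k, η k * e k) ^ 2) / 2), integral_div,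
      integral_add (integrable_const _) (memLp_linear_gaussian e).integrable_sq,
      integral_linear_sq_gaussian]
    simp
    linarith
  refine (integral_fst_add_mul_add_snd_le
    (f₁ := fun a => |xOf a j - x j| + |c| * |yOf a j - y j| + |y j| * |c - c'|)
    (f₂ := fun a => |(√(1 + sqLen a))⁻¹ - √(1 - ip x x - ip y y)|)
    (fun p => le_min (abs_nonneg _) zero_le_one) (fun p => ?_)
    (((integrable_abs_xOf_sub τ _ j).fun_add
      ((integrable_abs_yOf_sub τ _ j).const_mul |c|)).fun_add (integrable_const _))
    (integrable_abs_inv_sqrt_sub τ _) hg hk).trans ?_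
  · have hmain := min_abs_coupling_le (X := xOf p.1 j) (Y := yOf p.1 j) (x := x j) (y := y j)
      (A := (√(1 + sqLen p.1))⁻¹) (A' := √(1 - ip x x - ip y y)) (c := c) (c' := c')
      (Q := ∑ k, p.2.2 k * e k) (R := √(sqLen p.2.2)) (ε := (2 * √(n : ℝ))⁻¹)
      (z := p.2.1 (Sum.inl j)) (z' := p.2.1 (Sum.inr j)) (r := √n) (δ := √d) hr hδ
      (inv_sqrt_one_add_sqLen_mem _) hA' (Real.sqrt_nonneg _) (by positivity) (by
        rw [mul_inv, one_div]
        exact mul_le_of_le_one_right (by norm_num) (inv_le_one_of_one_le₀ hr))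
    rw [hrd, Real.sq_sqrt (sqLen_nonneg _)] at hmain
    rw [extendCfg_coneVec_apply hb, sumVec_apply hb, hv, pureMean, mul_div_assoc]
    exact hmain
  · rw [integral_add ((integrable_abs_xOf_sub τ _ j).fun_add
      ((integrable_abs_yOf_sub τ _ j).const_mul |c|)) (integrable_const _),
      integral_add (integrable_abs_xOf_sub τ _ j) ((integrable_abs_yOf_sub τ _ j).const_mul |c|),
      integral_const_mul, integral_const]
    simp only [probReal_univ, one_smul]
    refine add_le_add (add_le_add le_rfl (mul_le_of_le_one_right ?_ hg')) hk'
    exact integral_nonneg fun _ => abs_nonneg _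

end CouplingLimit

section ParamLimit

open ProbabilityTheory

variable {d : ℕ}

lemma expTilt_tiltFn_univ_ne_top (hd : 1 ≤ d) {β : ℝ} (hβ : 0 < β) (m s : Fin d → ℝ) {n : ℕ}
    (hn : 3 ≤ n) : expTilt volume n (tiltFn β m s) Set.univ ≠ ⊤ := by
  refine expTilt_univ_ne_top hn (Φ := tiltFn β m s) (ε := 0)
    (M := β * (1 + ∑ j, |m j| + ∑ j, |s j|)) (fun a => by simp)
    (fun a => (tiltFn_le hβ m s a).trans ?_) (lintegral_exp_tiltFn_ne_top hd hβ m s)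
  have : 0 ≤ (d : ℝ) / 2 * Real.log (1 + sqLen a) :=
    mul_nonneg (by positivity) (Real.log_nonneg (by linarith [sqLen_nonneg a]))
  exact sub_le_self _ this

lemma isProbabilityMeasure_paramLaw (hd : 1 ≤ d) {β : ℝ} (hβ : 0 < β) (h : ℕ → Fin d → ℝ) {n : ℕ}
    (hn : 3 ≤ n) : IsProbabilityMeasure (paramLaw d n β h) := by
  constructor
  rw [paramLaw, Measure.smul_apply, smul_eq_mul]
  exact ENNReal.inv_mul_cancel
    (expTilt_univ_ne_zero n (continuous_tiltFn β _ _).measurable)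
    (expTilt_tiltFn_univ_ne_top hd hβ _ _ hn)

lemma tendsto_integral_paramLaw (hd : 1 ≤ d) {β : ℝ} (hβ : 0 < β) {h : ℕ → Fin d → ℝ}
    {m s : Fin d → ℝ} (hm : Tendsto (sampleMean d h) atTop (𝓝 m))
    (hs : Tendsto (sampleStd d h) atTop (𝓝 s)) {a₀ : Fin d ⊕ Fin d → ℝ}
    (hmax : ∀ a, a ≠ a₀ → tiltFn β m s a < tiltFn β m s a₀) {g : (Fin d ⊕ Fin d → ℝ) → ℝ}
    (hg0 : ∀ a, 0 ≤ g a) {B : ℝ} (hB : ∀ a, g a ≤ B) (hc : Continuous g) (hga : g a₀ = 0) :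
    Tendsto (fun n => ∫ a, g a ∂(paramLaw d n β h)) atTop (𝓝 0) := by
  refine tendsto_integral_of_concentrating (n₀ := 3)
    (fun n hn => isProbabilityMeasure_paramLaw hd hβ h hn) (fun U hU ha₀ => ?_) hg0 hB hc hga
  obtain ⟨δ, hδ, hgap⟩ := exists_gap hd hβ hmax hU ha₀
  have hε : Tendsto (fun n => β * (∑ j, |sampleMean d h n j - m j| +
      ∑ j, |sampleStd d h n j - s j|)) atTop (𝓝 0) := by
    have h1 (j : Fin d) : Tendsto (fun n => |sampleMean d h n j - m j|) atTop (𝓝 0) := by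
      simpa using ((tendsto_pi_nhds.1 hm j).sub_const (m j)).abs
    have h2 (j : Fin d) : Tendsto (fun n => |sampleStd d h n j - s j|) atTop (𝓝 0) := by
      simpa using ((tendsto_pi_nhds.1 hs j).sub_const (s j)).abs
    simpa using ((tendsto_finsetSum Finset.univ fun j _ => h1 j).add
      (tendsto_finsetSum Finset.univ fun j _ => h2 j)).const_mul β
  exact tendsto_expTilt_compl volume (continuous_tiltFn β m s) hε
    (fun n a => abs_tiltFn_sub_le hβ m s _ _ a) (lintegral_exp_tiltFn_ne_top hd hβ m s)
    hU.measurableSet hδ hgap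

/-- The upper bound for the expected truncated distance between the coupled `(i, j)` spins. -/
noncomputable def couplingBound (d : ℕ) (β : ℝ) (h : ℕ → Fin d → ℝ) (m s x y : Fin d → ℝ)
    (i : ℕ) (j : Fin d) (n : ℕ) : ℝ :=
  ∫ a, |xOf a j - x j| ∂(paramLaw d n β h) +
    |(h i j - sampleMean d h n j) / sampleStd d h n j| *
      ∫ a, |yOf a j - y j| ∂(paramLaw d n β h) +
    |y j| * |(h i j - sampleMean d h n j) / sampleStd d h n j - (h i j - m j) / s j| +
    ∫ a, |(√(1 + sqLen a))⁻¹ - √(1 - ip x x - ip y y)| ∂(paramLaw d n β h) +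
    (16 * d ^ 2 + 4 * ∫ x, (x ^ 2 - 1) ^ 2 ∂(gaussianReal 0 1) + 2 +
      |(h i j - sampleMean d h n j) / sampleStd d h n j|) / √n

lemma tendsto_couplingBound (hd : 1 ≤ d) {β : ℝ} (hβ : 0 < β) {h : ℕ → Fin d → ℝ}
    {m s x y : Fin d → ℝ} (hm : Tendsto (sampleMean d h) atTop (𝓝 m))
    (hs : Tendsto (sampleStd d h) atTop (𝓝 s)) (hspos : ∀ j, 0 < s j) (hxy : inBall d x y)
    (hmax : ∀ a, a ≠ ballParam x y → tiltFn β m s a < tiltFn β m s (ballParam x y))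
    (i : ℕ) (j : Fin d) : Tendsto (couplingBound d β h m s x y i j) atTop (𝓝 0) := by
  obtain ⟨hx, hy⟩ := xOf_ballParam hxy
  have t1 : Tendsto (fun n => ∫ a, |xOf a j - x j| ∂(paramLaw d n β h)) atTop (𝓝 0) := by
    have := continuous_xOf (d := d)
    exact tendsto_integral_paramLaw hd hβ hm hs hmax (fun a => abs_nonneg _) (B := 1 + |x j|)
      (fun a => (abs_sub _ _).trans (by linarith [abs_xOf_le a j])) (by fun_prop) (by simp [hx])
  have t2 : Tendsto (fun n => ∫ a, |yOf a j - y j| ∂(paramLaw d n β h)) atTop (𝓝 0) := by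
    have := continuous_yOf (d := d)
    exact tendsto_integral_paramLaw hd hβ hm hs hmax (fun a => abs_nonneg _) (B := 1 + |y j|)
      (fun a => (abs_sub _ _).trans (by linarith [abs_yOf_le a j])) (by fun_prop) (by simp [hy])
  have t3 : Tendsto (fun n => ∫ a, |(√(1 + sqLen a))⁻¹ - √(1 - ip x x - ip y y)|
      ∂(paramLaw d n β h)) atTop (𝓝 0) := by
    refine tendsto_integral_paramLaw hd hβ hm hs hmax (fun a => abs_nonneg _)
      (B := 1 + |√(1 - ip x x - ip y y)|)
      (fun a => (abs_sub _ _).trans (by linarith [inv_sqrt_one_add_sqLen_mem a]))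
      (continuous_inv_sqrt_one_add_sqLen.sub continuous_const).abs ?_
    rw [sqLen_ballParam hxy, Real.sqrt_inv, inv_inv, sub_self, abs_zero]
  have tc : Tendsto (fun n => (h i j - sampleMean d h n j) / sampleStd d h n j) atTop
      (𝓝 ((h i j - m j) / s j)) :=
    ((tendsto_pi_nhds.1 hm j).const_sub _).div (tendsto_pi_nhds.1 hs j) (hspos j).ne'
  have tr : Tendsto (fun n : ℕ => (√(n : ℝ))⁻¹) atTop (𝓝 0) :=
    (Real.tendsto_sqrt_atTop.comp tendsto_natCast_atTop_atTop).inv_tendsto_atTop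
  have t4 : Tendsto (fun n => |(h i j - sampleMean d h n j) / sampleStd d h n j -
      (h i j - m j) / s j|) atTop (𝓝 0) := by
    simpa using (tc.sub_const ((h i j - m j) / s j)).abs
  have t5 := (tc.abs.const_add
    (16 * (d : ℝ) ^ 2 + 4 * ∫ x, (x ^ 2 - 1) ^ 2 ∂(gaussianReal 0 1) + 2)).mul tr
  have := (((t1.add (tc.abs.mul t2)).add (t4.const_mul |y j|)).add t3).add t5
  rw [mul_zero, mul_zero, mul_zero, add_zero, add_zero, add_zero, add_zero] at this
  exact this

end ParamLimit

section CfgMetric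

variable {d : ℕ}

lemma w_pos (p : ℕ × Fin d) : 0 < w d p := by
  unfold w
  positivity

lemma summable_w (d : ℕ) : Summable (w d) := by
  have h1 : Summable fun i : ℕ => ((1 : ℝ) / 2) ^ (i + 1) :=
    (summable_nat_add_iff 1).2 (summable_geometric_of_lt_one (by norm_num) (by norm_num))
  have h2 : Summable fun j : Fin d => ((1 : ℝ) / 2) ^ ((j : ℕ) + 1) := Summable.of_finite
  refine (h1.mul_of_nonneg h2 (fun _ => by positivity) fun _ => by positivity).congr fun p => ?_
  rw [w, pow_add _ (p.1 + 1)]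

lemma summable_w_mul {u : ℕ × Fin d → ℝ} (h0 : ∀ p, 0 ≤ u p) (h1 : ∀ p, u p ≤ 1) :
    Summable fun p => w d p * u p :=
  Summable.of_nonneg_of_le (fun p => mul_nonneg (w_pos p).le (h0 p))
    (fun p => mul_le_of_le_one_right (w_pos p).le (h1 p)) (summable_w d)

lemma Cd_nonneg (d : ℕ) : 0 ≤ Cd d := tsum_nonneg fun p => (w_pos p).le

lemma summable_cfgDist (φ φ' : ℕ → Fin d → ℝ) :
    Summable fun p : ℕ × Fin d => w d p * min |φ p.1 p.2 - φ' p.1 p.2| 1 :=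
  summable_w_mul (fun _ => le_min (abs_nonneg _) zero_le_one) fun _ => min_le_right _ _

lemma cfgDist_nonneg (φ φ' : ℕ → Fin d → ℝ) : 0 ≤ cfgDist d φ φ' :=
  mul_nonneg (inv_nonneg.2 (Cd_nonneg d)) (tsum_nonneg fun p =>
    mul_nonneg (w_pos p).le (le_min (abs_nonneg _) zero_le_one))

lemma cfgDist_le_one (φ φ' : ℕ → Fin d → ℝ) : cfgDist d φ φ' ≤ 1 := by
  have h : ∑' p : ℕ × Fin d, w d p * min |φ p.1 p.2 - φ' p.1 p.2| 1 ≤ Cd d :=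
    (summable_cfgDist φ φ').tsum_le_tsum
      (fun p => mul_le_of_le_one_right (w_pos p).le (min_le_right _ _)) (summable_w d)
  calc cfgDist d φ φ' ≤ (Cd d)⁻¹ * Cd d :=
        mul_le_mul_of_nonneg_left h (inv_nonneg.2 (Cd_nonneg d))
    _ ≤ 1 := inv_mul_le_one

lemma continuous_cfgDist :
    Continuous fun q : (ℕ → Fin d → ℝ) × (ℕ → Fin d → ℝ) => cfgDist d q.1 q.2 := by
  unfold cfgDist
  refine continuous_const.mul (continuous_tsum (u := w d) (fun p => by fun_prop) (summable_w d)
    fun p q => ?_)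
  rw [Real.norm_eq_abs, abs_of_nonneg
    (mul_nonneg (w_pos p).le (le_min (abs_nonneg _) zero_le_one))]
  exact mul_le_of_le_one_right (w_pos p).le (min_le_right _ _)

lemma continuous_of_abs_sub_le_cfgDist {f : (ℕ → Fin d → ℝ) → ℝ}
    (hf : ∀ φ φ', |f φ - f φ'| ≤ cfgDist d φ φ') : Continuous f := by
  refine continuous_iff_continuousAt.2 fun φ => ?_
  have h1 : Tendsto (fun φ' => cfgDist d φ' φ) (𝓝 φ) (𝓝 0) := by
    have h2 : Continuous fun φ' => cfgDist d φ' φ :=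
      continuous_cfgDist.comp (continuous_id.prodMk continuous_const)
    have h3 : cfgDist d φ φ = 0 := by simp [cfgDist]
    simpa [h3] using h2.tendsto φ
  refine tendsto_iff_dist_tendsto_zero.2 (squeeze_zero (fun _ => dist_nonneg) (fun φ' => ?_) h1)
  rw [Real.dist_eq]
  exact hf φ' φ

lemma abs_integral_sub_le_integral_cfgDist {Ω : Type*} [MeasurableSpace Ω] (P : Measure Ω)
    [IsProbabilityMeasure P] {G Θ : Ω → ℕ → Fin d → ℝ} (hG : Measurable G) (hΘ : Measurable Θ)
    {f : (ℕ → Fin d → ℝ) → ℝ} (hf1 : ∀ φ, |f φ| ≤ 1)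
    (hf : ∀ φ φ', |f φ - f φ'| ≤ cfgDist d φ φ') :
    |∫ ω, f (G ω) ∂P - ∫ ω, f (Θ ω) ∂P| ≤ ∫ ω, cfgDist d (G ω) (Θ ω) ∂P := by
  have hfm := (continuous_of_abs_sub_le_cfgDist hf).measurable
  have hi {F : Ω → ℕ → Fin d → ℝ} (hF : Measurable F) : Integrable (fun ω => f (F ω)) P :=
    Integrable.of_bound (hfm.comp hF).aestronglyMeasurable 1 (ae_of_all _ fun ω => hf1 _)
  have hc : Integrable (fun ω => cfgDist d (G ω) (Θ ω)) P :=
    Integrable.of_bound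
      (continuous_cfgDist.measurable.comp (hG.prodMk hΘ)).aestronglyMeasurable 1
      (ae_of_all _ fun ω => by
        rw [Real.norm_eq_abs, abs_of_nonneg (cfgDist_nonneg _ _)]
        exact cfgDist_le_one _ _)
  rw [← integral_sub (hi hG) (hi hΘ)]
  exact (abs_integral_le_integral_abs).trans
    (integral_mono ((hi hG).sub (hi hΘ)).abs hc fun ω => hf _ _)

/-- Extension by zero of a finite configuration. -/
noncomputable def zeroExtend (d n : ℕ) (u : Fin n → Fin d → ℝ) : ℕ → Fin d → ℝ :=
  fun i j => if hi : i < n then u ⟨i, hi⟩ j else 0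

@[fun_prop]
lemma measurable_zeroExtend {n : ℕ} : Measurable (zeroExtend d n) := by
  unfold zeroExtend
  refine measurable_pi_lambda _ fun i => measurable_pi_lambda _ fun j => ?_
  by_cases hi : i < n
  · simp only [hi, dif_pos]
    fun_prop
  · simp [hi]

lemma cfgDist_zeroExtend_le (n : ℕ) (φ : ℕ → Fin d → ℝ) :
    cfgDist d (zeroExtend d n fun i => φ i) φ ≤
      (Cd d)⁻¹ * ∑' p : ℕ × Fin d, w d p * (if p.1 < n then 0 else 1) := by
  refine mul_le_mul_of_nonneg_left ?_ (inv_nonneg.2 (Cd_nonneg d))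
  refine (summable_cfgDist _ _).tsum_le_tsum (fun p => ?_) (summable_w_mul
    (fun p => by split_ifs <;> norm_num) fun p => by split_ifs <;> norm_num)
  refine mul_le_mul_of_nonneg_left ?_ (w_pos p).le
  split_ifs with hp
  · simp [zeroExtend, hp]
  · exact min_le_right _ _

lemma integral_cfgDist_le {Ω : Type*} [MeasurableSpace Ω] (P : Measure Ω)
    [IsProbabilityMeasure P] {G Θ : Ω → ℕ → Fin d → ℝ} (hG : Measurable G) (hΘ : Measurable Θ)
    {n : ℕ} (h0 : ∀ ω i j, n ≤ i → G ω i j = Θ ω i j) {B : ℕ × Fin d → ℝ}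
    (hB : ∀ p : ℕ × Fin d, p.1 < n →
      ∫ ω, min |G ω p.1 p.2 - Θ ω p.1 p.2| 1 ∂P ≤ B p) :
    ∫ ω, cfgDist d (G ω) (Θ ω) ∂P ≤
      (Cd d)⁻¹ * ∑' p : ℕ × Fin d, w d p * (if p.1 < n then B p else 0) := by
  set S : Finset (ℕ × Fin d) := Finset.range n ×ˢ Finset.univ with hS
  have hmem (p : ℕ × Fin d) : p ∈ S ↔ p.1 < n := by simp [hS]
  have h1 (ω : Ω) : cfgDist d (G ω) (Θ ω) =
      (Cd d)⁻¹ * ∑ p ∈ S, w d p * min |G ω p.1 p.2 - Θ ω p.1 p.2| 1 := by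
    rw [cfgDist, tsum_eq_sum]
    intro p hp
    rw [h0 ω p.1 p.2 (not_lt.1 fun h => hp ((hmem p).2 h))]
    simp
  have hi (p : ℕ × Fin d) : Integrable (fun ω => min |G ω p.1 p.2 - Θ ω p.1 p.2| 1) P := by
    have g1 : Measurable fun ω => G ω p.1 p.2 := by fun_prop
    have g2 : Measurable fun ω => Θ ω p.1 p.2 := by fun_prop
    refine Integrable.of_bound ((g1.sub g2).abs.min measurable_const).aestronglyMeasurable 1
      (ae_of_all _ fun ω => ?_)
    rw [Real.norm_eq_abs, abs_of_nonneg (le_min (abs_nonneg _) zero_le_one)]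
    exact min_le_right _ _
  simp_rw [h1]
  rw [integral_const_mul, integral_finsetSum _ fun p _ => (hi p).const_mul _]
  refine mul_le_mul_of_nonneg_left ?_ (inv_nonneg.2 (Cd_nonneg d))
  rw [tsum_eq_sum (s := S) fun p hp => by rw [if_neg fun h => hp ((hmem p).2 h), mul_zero]]
  refine Finset.sum_le_sum fun p hp => ?_
  rw [integral_const_mul, if_pos ((hmem p).1 hp)]
  exact mul_le_mul_of_nonneg_left (hB p ((hmem p).1 hp)) (w_pos p).le

end CfgMetric

section GibbsLimit

open ProbabilityTheory

variable {d : ℕ}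

lemma couplingBound_nonneg (β : ℝ) (h : ℕ → Fin d → ℝ) (m s x y : Fin d → ℝ) (i : ℕ) (j : Fin d)
    (n : ℕ) : 0 ≤ couplingBound d β h m s x y i j n := by
  have h1 : 0 ≤ ∫ a, |xOf a j - x j| ∂(paramLaw d n β h) := integral_nonneg fun _ => abs_nonneg _
  have h2 : 0 ≤ ∫ a, |yOf a j - y j| ∂(paramLaw d n β h) := integral_nonneg fun _ => abs_nonneg _
  have h3 : 0 ≤ ∫ a, |(√(1 + sqLen a))⁻¹ - √(1 - ip x x - ip y y)| ∂(paramLaw d n β h) :=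
    integral_nonneg fun _ => abs_nonneg _
  have h4 : 0 ≤ ∫ x, (x ^ 2 - 1) ^ 2 ∂(gaussianReal 0 1) := integral_nonneg fun _ => sq_nonneg _
  unfold couplingBound
  positivity

lemma map_fst_snd_snd {α γ δ : Type*} [MeasurableSpace α] [MeasurableSpace γ] [MeasurableSpace δ]
    (τ : Measure α) (μ₁ : Measure γ) (μ₂ : Measure δ) [SFinite τ]
    [IsProbabilityMeasure μ₁] [SFinite μ₂] :
    (τ.prod (μ₁.prod μ₂)).map (fun p => (p.1, p.2.2)) = τ.prod μ₂ := by
  have h2 : (μ₁.prod μ₂).map Prod.snd = μ₂ := by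
    rw [Measure.map_snd_prod, measure_univ, one_smul]
  have h := Measure.map_prod_map τ (μ₁.prod μ₂) measurable_id measurable_snd
  rw [Measure.map_id, h2] at h
  exact h.symm

lemma abs_integral_gibbs_sub_le (hd : 1 ≤ d) {β : ℝ} (hβ : 0 < β) {h : ℕ → Fin d → ℝ}
    {m s x y : Fin d → ℝ} (hxy : inBall d x y) {n : ℕ} (hn : 3 ≤ n)
    (hstd : ∀ j, 0 < sampleStd d h n j) {ν : Measure (ℕ → Fin d → ℝ)}
    (hν : IsProdGaussian d (pureMean d h m s x y) (pureVar d x y) ν)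
    {f : (ℕ → Fin d → ℝ) → ℝ} (hf1 : ∀ φ, |f φ| ≤ 1)
    (hf : ∀ φ φ', |f φ - f φ'| ≤ cfgDist d φ φ') :
    |∫ φ, f φ ∂(gibbs d n β h) - ∫ φ, f φ ∂ν| ≤ (Cd d)⁻¹ * ∑' p : ℕ × Fin d,
      w d p * (if p.1 < n then min 1 (couplingBound d β h m s x y p.1 p.2 n) else 1) := by
  obtain ⟨hν1, hνn⟩ := hν
  have hfm := (continuous_of_abs_sub_le_cfgDist hf).measurable
  obtain ⟨b, hb⟩ := exists_fieldBasis hn h hstd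
  have hcard : Fintype.card (Fin ((n - 2) * d)) + 2 * d = n * d := by
    rw [Fintype.card_fin, ← add_mul]
    congr 1
    omega
  have := isProbabilityMeasure_paramLaw hd hβ h hn
  set τ := paramLaw d n β h with hτ
  set γ : Measure ((Fin d ⊕ Fin d → ℝ) × (Fin ((n - 2) * d) → ℝ)) :=
    (Measure.pi fun _ => gaussianReal 0 1).prod (Measure.pi fun _ => gaussianReal 0 1) with hγ
  set G : (Fin d ⊕ Fin d → ℝ) × ((Fin d ⊕ Fin d → ℝ) × (Fin ((n - 2) * d) → ℝ)) →
    ℕ → Fin d → ℝ := fun p => extendCfg d n (coneVec b (p.1, p.2.2)) with hG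
  set T : (Fin d ⊕ Fin d → ℝ) × (Fin ((n - 2) * d) → ℝ) → Fin n → Fin d → ℝ :=
    fun p i j => pureMean d h m s x y i j + √(pureVar d x y) * sumVec b p (i, j) with hT
  have hGm : Measurable G :=
    measurable_extendCfg.comp ((measurable_coneVec b).comp (by fun_prop))
  have hTm : Measurable T := by
    have := continuous_sumVec b
    exact measurable_pi_lambda _ fun i => measurable_pi_lambda _ fun j => by fun_prop
  have hΘm : Measurable fun p : (Fin d ⊕ Fin d → ℝ) ×
      ((Fin d ⊕ Fin d → ℝ) × (Fin ((n - 2) * d) → ℝ)) => zeroExtend d n (T p.2) :=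
    measurable_zeroExtend.comp (hTm.comp measurable_snd)
  have e1 : ∫ φ, f φ ∂(gibbs d n β h) = ∫ p, f (G p) ∂(τ.prod γ) := by
    rw [gibbs_eq hd hn β h hstd (expTilt_tiltFn_univ_ne_top hd hβ _ _ hn) b hb, ← hτ,
      ← map_fst_snd_snd τ (Measure.pi fun _ : Fin d ⊕ Fin d => gaussianReal 0 1),
      Measure.map_map (g := fun p => extendCfg d n (coneVec b p))
        (f := fun p : (Fin d ⊕ Fin d → ℝ) ×
          ((Fin d ⊕ Fin d → ℝ) × (Fin ((n - 2) * d) → ℝ)) => (p.1, p.2.2))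
        (measurable_extendCfg.comp (measurable_coneVec b)) (by fun_prop)]
    exact integral_map (Measurable.aemeasurable hGm) hfm.aestronglyMeasurable
  have hrm : Measurable fun (φ : ℕ → Fin d → ℝ) (i : Fin n) => φ i :=
    measurable_pi_lambda _ fun i => measurable_pi_apply _
  have e2 : ∫ φ, f (zeroExtend d n fun i => φ i) ∂ν =
      ∫ p, f (zeroExtend d n (T p.2)) ∂(τ.prod γ) := by
    have hz : Measurable fun u => f (zeroExtend d n u) := hfm.comp measurable_zeroExtend
    rw [integral_fun_snd (fun q => f (zeroExtend d n (T q))), probReal_univ, one_smul,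
      ← integral_map (φ := T) (f := fun u => f (zeroExtend d n u)) hTm.aemeasurable
        hz.aestronglyMeasurable,
      ← integral_map (φ := fun (φ : ℕ → Fin d → ℝ) (i : Fin n) => φ i)
        (f := fun u => f (zeroExtend d n u)) hrm.aemeasurable hz.aestronglyMeasurable, hνn n,
      ← map_affine_sumVec b (fun i j => pureMean d h m s x y i j) (pureVar d x y)]
  have b1 : |∫ p, f (G p) ∂(τ.prod γ) - ∫ p, f (zeroExtend d n (T p.2)) ∂(τ.prod γ)| ≤
      (Cd d)⁻¹ * ∑' p : ℕ × Fin d,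
        w d p * (if p.1 < n then min 1 (couplingBound d β h m s x y p.1 p.2 n) else 0) := by
    refine (abs_integral_sub_le_integral_cfgDist (τ.prod γ) hGm hΘm hf1 hf).trans
      (integral_cfgDist_le _ hGm hΘm (fun ω i j hi => ?_) fun p hp => le_min ?_ ?_)
    · simp [hG, extendCfg, zeroExtend, hi.not_gt]
    · refine (integral_mono_of_nonneg (ae_of_all _ fun _ => le_min (abs_nonneg _) zero_le_one)
        (integrable_const 1) (ae_of_all _ fun _ => min_le_right _ _)).trans ?_
      simp
    · simp only [zeroExtend, hp, dif_pos]
      exact integral_coupling_le hd hcard hb hxy τ ⟨p.1, hp⟩ p.2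
  have b2 : |∫ φ, f (zeroExtend d n fun i => φ i) ∂ν - ∫ φ, f φ ∂ν| ≤
      (Cd d)⁻¹ * ∑' p : ℕ × Fin d, w d p * (if p.1 < n then 0 else 1) := by
    refine (abs_integral_sub_le_integral_cfgDist ν (Θ := fun φ => φ)
      (measurable_zeroExtend.comp hrm) measurable_id hf1 hf).trans ?_
    refine (integral_mono_of_nonneg (ae_of_all _ fun _ => cfgDist_nonneg _ _)
        (integrable_const _) (ae_of_all _ fun φ => cfgDist_zeroExtend_le n φ)).trans ?_
    simp
  have hmin (p : ℕ × Fin d) : 0 ≤ min 1 (couplingBound d β h m s x y p.1 p.2 n) :=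
    le_min zero_le_one (couplingBound_nonneg β h m s x y p.1 p.2 n)
  calc _ ≤ _ := abs_sub_le _ (∫ φ, f (zeroExtend d n fun i => φ i) ∂ν) _
    _ ≤ _ := add_le_add (e1 ▸ e2 ▸ b1) b2
    _ = _ := by
      rw [← mul_add, ← Summable.tsum_add]
      · congr 2 with p
        split_ifs <;> ring
      · refine summable_w_mul (fun p => ?_) fun p => ?_
        · split_ifs
          exacts [hmin p, le_rfl]
        · split_ifs
          exacts [min_le_left _ _, zero_le_one]
      · exact summable_w_mul (fun p => by split_ifs <;> norm_num) fun p => by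
          split_ifs <;> norm_num

lemma tendsto_blDistCfg_gibbs (hd : 1 ≤ d) {β : ℝ} (hβ : 0 < β) {h : ℕ → Fin d → ℝ}
    {m s x y : Fin d → ℝ} (hm : Tendsto (sampleMean d h) atTop (𝓝 m))
    (hs : Tendsto (sampleStd d h) atTop (𝓝 s)) (hspos : ∀ j, 0 < s j) (hxy : inBall d x y)
    (hmax : ∀ a, a ≠ ballParam x y → tiltFn β m s a < tiltFn β m s (ballParam x y))
    {ν : Measure (ℕ → Fin d → ℝ)}
    (hν : IsProdGaussian d (pureMean d h m s x y) (pureVar d x y) ν) :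
    Tendsto (fun n => blDistCfg d (gibbs d n β h) ν) atTop (𝓝 0) := by
  have hmin (p : ℕ × Fin d) (n : ℕ) : 0 ≤ min 1 (couplingBound d β h m s x y p.1 p.2 n) :=
    le_min zero_le_one (couplingBound_nonneg β h m s x y p.1 p.2 n)
  have hite (p : ℕ × Fin d) (n : ℕ) :
      0 ≤ (if p.1 < n then min 1 (couplingBound d β h m s x y p.1 p.2 n) else 1) ∧
      (if p.1 < n then min 1 (couplingBound d β h m s x y p.1 p.2 n) else 1) ≤ 1 := by
    split_ifs
    exacts [⟨hmin p n, min_le_left _ _⟩, ⟨zero_le_one, le_rfl⟩]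
  have hlim : Tendsto (fun n => (Cd d)⁻¹ * ∑' p : ℕ × Fin d,
      w d p * (if p.1 < n then min 1 (couplingBound d β h m s x y p.1 p.2 n) else 1))
      atTop (𝓝 0) := by
    have h1 : Tendsto (fun n => ∑' p : ℕ × Fin d,
        w d p * (if p.1 < n then min 1 (couplingBound d β h m s x y p.1 p.2 n) else 1))
        atTop (𝓝 (∑' _ : ℕ × Fin d, (0 : ℝ))) := by
      refine tendsto_tsum_of_dominated_convergence (summable_w d) (fun p => ?_)
        (Eventually.of_forall fun n p => ?_)
      · have h2 : Tendsto (fun n => w d p * min 1 (couplingBound d β h m s x y p.1 p.2 n)) atTop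
            (𝓝 (w d p * min 1 0)) :=
          (tendsto_const_nhds.min
            (tendsto_couplingBound hd hβ hm hs hspos hxy hmax p.1 p.2)).const_mul _
        rw [min_eq_right zero_le_one, mul_zero] at h2
        refine h2.congr' ?_
        filter_upwards [eventually_gt_atTop p.1] with n hn
        rw [if_pos hn]
      · rw [Real.norm_eq_abs, abs_of_nonneg (mul_nonneg (w_pos p).le (hite p n).1)]
        exact mul_le_of_le_one_right (w_pos p).le (hite p n).2
    simpa using h1.const_mul (Cd d)⁻¹
  have hstd : ∀ᶠ n in atTop, ∀ j, 0 < sampleStd d h n j :=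
    eventually_all.2 fun j => (tendsto_pi_nhds.1 hs j).eventually_const_lt (hspos j)
  refine squeeze_zero' (Eventually.of_forall fun n => Real.sSup_nonneg ?_) ?_ hlim
  · rintro _ ⟨f, -, -, rfl⟩
    exact abs_nonneg _
  · filter_upwards [hstd, eventually_ge_atTop 3] with n hn1 hn3
    refine Real.sSup_le ?_ (mul_nonneg (inv_nonneg.2 (Cd_nonneg d))
      (tsum_nonneg fun p => mul_nonneg (w_pos p).le (hite p n).1))
    rintro _ ⟨f, hf1, hf, rfl⟩
    exact abs_integral_gibbs_sub_le hd hβ hxy hn3 hn1 hν hf1 hf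

end GibbsLimit

/-- Convergence of the finite-volume Gibbs states in the non-ferromagnetic regime:
the limiting tilting function has a unique global maximizing point (x*,y*) and the
Gibbs states converge in bounded Lipschitz distance to the product state ν^{x*,y*,h}. -/
theorem stmt15 (d : ℕ) (hd : 1 ≤ d) (β : ℝ) (hβ : 0 < β) (h : ℕ → Fin d → ℝ)
    (m s : Fin d → ℝ)
    (hm : Tendsto (sampleMean d h) atTop (𝓝 m))
    (hs : Tendsto (sampleStd d h) atTop (𝓝 s))
    (hspos : ∀ j, 0 < s j)
    (hsum : Summable (fun p : ℕ × Fin d => |h p.1 p.2| * w d p))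
    (hcase : m ≠ 0 ∨ (m = 0 ∧ 1 ≤ ip s s) ∨
      (m = 0 ∧ ip s s < 1 ∧ β ≤ (d : ℝ) / (1 - ip s s))) :
    ∃ q : (Fin d → ℝ) × (Fin d → ℝ),
      (inBall d q.1 q.2 ∧
        (∀ x y : Fin d → ℝ, inBall d x y → psi d β m s x y ≤ psi d β m s q.1 q.2)) ∧
      (∀ p : (Fin d → ℝ) × (Fin d → ℝ), inBall d p.1 p.2 →
        (∀ x y : Fin d → ℝ, inBall d x y → psi d β m s x y ≤ psi d β m s p.1 p.2) →
        p = q) ∧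
      ∀ ν : Measure (ℕ → Fin d → ℝ),
        IsProdGaussian d (pureMean d h m s q.1 q.2) (pureVar d q.1 q.2) ν →
        Tendsto (fun n : ℕ => blDistCfg d (gibbs d n β h) ν) atTop (𝓝 0) := by
  obtain ⟨x, y, u, hu, hx, hy, huxy, hβu, hor⟩ := exists_stationary hd hβ m s hcase
  have hxy : inBall d x y := by
    unfold inBall
    linarith
  have hmax (x' y' : Fin d → ℝ) (h' : inBall d x' y') :=
    isMax_psi hd hu hx hy huxy hβu hor h'
  refine ⟨(x, y), ⟨hxy, fun x' y' h' => (hmax x' y' h').1⟩, fun p hp hpmax => ?_, fun ν hν =>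
    tendsto_blDistCfg_gibbs hd hβ hm hs hspos hxy (fun a ha => tiltFn_lt_of_unique hxy hmax a ha)
      hν⟩
  obtain ⟨h1, h2⟩ := (hmax p.1 p.2 hp).2 (hpmax x y hxy)
  exact Prod.ext h1 h2
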